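/- Let Ω be a finite set and let G be a nontrivial solvable subgroup of the symmetric group on Ω. Then (G, Ω) is nice: there exist subsets Δ₁ and Δ₂ of Ω with |Δ₁| < |Δ₂| and 2|Δ₂| ≤ |Ω| such that for j = 1, 2, the setwise stabilizer S_j of Δ_j in G has a normal elementary abelian 3-subgroup N_j (possibly trivial) with S_j/N_j a 2-group. -/

import Mathlib

open Pointwise

/-- A finite group `S` has the "required structure" if it has a (possibly trivial) normal
elementary abelian 3-subgroup `N` such that the quotient `S/N` is a 2-group. -/
def RequiredStructure (S : Type*) [Group S] : Prop :=
  ∃ (N : Subgroup S) (hN : N.Normal),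
    (∀ x ∈ N, ∀ y ∈ N, x * y = y * x) ∧ (∀ x ∈ N, x ^ 3 = 1) ∧
    @IsPGroup 2 (S ⧸ N) (@QuotientGroup.Quotient.group S _ N hN)

/-- A finite permutation group `(G, Ω)` is "nice" if there are subsets `Δ₁, Δ₂` of `Ω`
with `|Δ₁| < |Δ₂| ≤ |Ω|/2` whose setwise stabilizers in `G` both have the required
structure. -/
def IsNice (Ω : Type*) [Fintype Ω] (G : Subgroup (Equiv.Perm Ω)) : Prop :=
  ∃ Δ₁ Δ₂ : Set Ω, Δ₁.ncard < Δ₂.ncard ∧ 2 * Δ₂.ncard ≤ Fintype.card Ω ∧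
    RequiredStructure (MulAction.stabilizer G Δ₁) ∧
    RequiredStructure (MulAction.stabilizer G Δ₂)

/-- A permutation group `(G, Ω)` is primitive if it is transitive and every block is trivial. -/
def IsPrimitivePermGroup (Ω : Type*) [Fintype Ω] (G : Subgroup (Equiv.Perm Ω)) : Prop :=
  MulAction.IsPretransitive G Ω ∧
    ∀ B : Set Ω, MulAction.IsBlock G B → MulAction.IsTrivialBlock B

namespace SolvableNice

open Equiv

/-! ### Elementwise form of the required structure -/

/-- Every element of `S` has 2-power order. -/
def TwoElements {M : Type*} [Monoid M] (S : Set M) : Prop :=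
  ∀ f ∈ S, ∃ m : ℕ, f ^ 2 ^ m = 1

/-- The elements of `S` of order dividing 3 commute and every element of `S` has order dividing
`3 * 2 ^ m` for some `m`. For a group this is the required structure. -/
def ThreeByTwo {M : Type*} [Monoid M] (S : Set M) : Prop :=
  (∀ f ∈ S, ∀ g ∈ S, f ^ 3 = 1 → g ^ 3 = 1 → f * g = g * f) ∧
    ∀ f ∈ S, ∃ m : ℕ, f ^ (3 * 2 ^ m) = 1

theorem TwoElements.mono {M : Type*} [Monoid M] {S T : Set M} (h : S ⊆ T) (hT : TwoElements T) :
    TwoElements S :=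
  fun f hf => hT f (h hf)

theorem eq_one_of_pow_three_of_pow_two_pow {M : Type*} [Monoid M] {f : M} {m : ℕ}
    (h3 : f ^ 3 = 1) (h2 : f ^ 2 ^ m = 1) : f = 1 := by
  have h : orderOf f ∣ Nat.gcd 3 (2 ^ m) :=
    Nat.dvd_gcd (orderOf_dvd_of_pow_eq_one h3) (orderOf_dvd_of_pow_eq_one h2)
  have : Nat.gcd 3 (2 ^ m) = 1 := Nat.Coprime.pow_right m (by norm_num)
  rw [this, Nat.dvd_one] at h
  exact orderOf_eq_one_iff.1 h

theorem TwoElements.threeByTwo {M : Type*} [Monoid M] {S : Set M} (h : TwoElements S) :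
    ThreeByTwo S := by
  refine ⟨fun f hf g hg hf3 _ => ?_, fun f hf => ?_⟩
  · obtain ⟨m, hm⟩ := h f hf
    rw [eq_one_of_pow_three_of_pow_two_pow hf3 hm, one_mul, mul_one]
  · obtain ⟨m, hm⟩ := h f hf
    exact ⟨m, by rw [mul_comm, pow_mul, hm, one_pow]⟩

theorem ThreeByTwo.requiredStructure {S : Type*} [Group S]
    (h : ThreeByTwo (Set.univ : Set S)) : RequiredStructure S := by
  let N : Subgroup S :=
    { carrier := {x | x ^ 3 = 1}
      one_mem' := one_pow 3
      mul_mem' := fun {a b} ha hb => by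
        have := h.1 a trivial b trivial ha hb
        simp only [Set.mem_ofPred_eq] at *
        rw [(show Commute a b from this).mul_pow, ha, hb, one_mul]
      inv_mem' := fun {a} ha => by
        simp only [Set.mem_ofPred_eq] at *
        rw [inv_pow, ha, inv_one] }
  have hN : N.Normal := ⟨fun n hn g => by
    change (g * n * g⁻¹) ^ 3 = 1
    rw [conj_pow, show n ^ 3 = 1 from hn, mul_one, mul_inv_cancel]⟩
  refine ⟨N, hN, fun x hx y hy => h.1 x trivial y trivial hx hy, fun x hx => hx, ?_⟩
  intro x
  induction x using QuotientGroup.induction_on with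
  | H x =>
    obtain ⟨m, hm⟩ := h.2 x trivial
    refine ⟨m, ?_⟩
    rw [← QuotientGroup.mk_pow, QuotientGroup.eq_one_iff]
    change (x ^ 2 ^ m) ^ 3 = 1
    rw [← pow_mul, mul_comm, hm]

/-- The elements of `P` that stabilize `D` setwise. -/
def permStab {α : Type*} (P : Set (Perm α)) (D : Set α) : Set (Perm α) :=
  {f | f ∈ P ∧ ∀ x, f x ∈ D ↔ x ∈ D}

theorem permStab_compl {α : Type*} (P : Set (Perm α)) (D : Set α) :
    permStab P Dᶜ = permStab P D := by
  ext f
  simp [permStab, not_iff_not]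

theorem pow_mem_iff {α : Type*} {f : Perm α} {D : Set α} (h : ∀ x, f x ∈ D ↔ x ∈ D) (n : ℕ) :
    ∀ x, (f ^ n) x ∈ D ↔ x ∈ D := by
  induction n with
  | zero => simp
  | succ n ih => intro x; rw [pow_succ, Perm.mul_apply, ih, h]

theorem perm_fin_three : ∀ n ≤ 3,
    (∀ a b : Perm (Fin n), a ^ 3 = 1 → b ^ 3 = 1 → a * b = b * a) ∧
      ∀ a : Perm (Fin n), a ^ 6 = 1 := by
  decide +kernel

/-- Two permutations stabilizing a set of at most three points and with trivial cubes commute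
there. -/
theorem commute_on_of_ncard_le_three {α : Type*} {D : Set α} (hD : D.Finite) (h3 : D.ncard ≤ 3)
    {f g : Perm α} (hf : ∀ x, f x ∈ D ↔ x ∈ D) (hg : ∀ x, g x ∈ D ↔ x ∈ D)
    (hf3 : f ^ 3 = 1) (hg3 : g ^ 3 = 1) : ∀ x ∈ D, f (g x) = g (f x) := by
  have := hD.fintype
  have e : D ≃ Fin D.ncard := by
    rw [Set.ncard_eq_toFinset_card', Set.toFinset_card]; exact Fintype.equivFin D
  have key : ∀ k : Perm α, (hk : ∀ x, k x ∈ D ↔ x ∈ D) → k ^ 3 = 1 →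
      (e.permCongrHom (k.subtypePerm hk)) ^ 3 = 1 := by
    intro k hk hk3
    rw [← map_pow, Perm.subtypePerm_pow]
    convert map_one e.permCongrHom
    ext x
    simp [hk3]
  have := (perm_fin_three _ h3).1 _ _ (key f hf hf3) (key g hg hg3)
  rw [← map_mul, ← map_mul] at this
  have := e.permCongrHom.injective this
  intro x hx
  exact congrArg Subtype.val (Equiv.congr_fun this ⟨x, hx⟩)

theorem pow_six_on_of_ncard_le_three {α : Type*} {D : Set α} (hD : D.Finite) (h3 : D.ncard ≤ 3)
    {f : Perm α} (hf : ∀ x, f x ∈ D ↔ x ∈ D) : ∀ x ∈ D, (f ^ 6) x = x := by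
  have := hD.fintype
  have e : D ≃ Fin D.ncard := by
    rw [Set.ncard_eq_toFinset_card', Set.toFinset_card]; exact Fintype.equivFin D
  have := (perm_fin_three _ h3).2 (e.permCongrHom (f.subtypePerm hf))
  rw [← map_pow, ← map_one e.permCongrHom] at this
  have := e.permCongrHom.injective this
  intro x hx
  have := congrArg Subtype.val (Equiv.congr_fun this ⟨x, hx⟩)
  simpa using this

/-- The stabilizer of a set of at most three points on which it acts faithfully. -/
theorem threeByTwo_of_ncard_le_three {α : Type*} (P : Subgroup (Perm α)) {D : Set α}
    (hD : D.Finite) (h3 : D.ncard ≤ 3)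
    (hfaith : ∀ f ∈ P, ∀ g ∈ P, (∀ x ∈ D, f x = g x) → f = g) :
    ThreeByTwo (permStab P D) := by
  refine ⟨fun f hf g hg hf3 hg3 => ?_, fun f hf => ⟨1, ?_⟩⟩
  · exact hfaith _ (P.mul_mem hf.1 hg.1) _ (P.mul_mem hg.1 hf.1)
      (commute_on_of_ncard_le_three hD h3 hf.2 hg.2 hf3 hg3)
  · exact hfaith _ (P.pow_mem hf.1 _) _ P.one_mem
      (pow_six_on_of_ncard_le_three hD h3 hf.2)

/-- The stabilizer of a set of at most two points on which it acts faithfully. -/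
theorem twoElements_of_pair {α : Type*} (P : Subgroup (Perm α)) {a b : α}
    (hfaith : ∀ f ∈ P, ∀ g ∈ P, f a = g a → f b = g b → f = g) :
    TwoElements (permStab P {a, b}) := by
  refine fun f hf => ⟨1, hfaith _ (P.pow_mem hf.1 _) _ P.one_mem ?_ ?_⟩
  all_goals
    have ha := (hf.2 a).2 (by simp)
    have hb := (hf.2 b).2 (by simp)
    simp only [Set.mem_insert_iff, Set.mem_singleton_iff] at ha hb
    have := f.injective.eq_iff (a := a) (b := b)
    simp only [pow_one, pow_two, Perm.mul_apply, Perm.one_apply]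
    grind

/-! ### Affine permutations -/

/-- The permutations of an abelian group that are affine. -/
def affPerm (V : Type*) [AddCommGroup V] : Subgroup (Perm V) where
  carrier := {f | ∀ x y z, f (x - y + z) = f x - f y + f z}
  one_mem' := fun _ _ _ => rfl
  mul_mem' := fun {f g} hf hg x y z => by
    simp only [Perm.mul_apply, Set.mem_ofPred_eq] at *
    rw [hg, hf]
  inv_mem' := fun {f} hf x y z => by
    simp only [Set.mem_ofPred_eq] at *
    apply f.injective
    simp [hf]

section Affine

variable {V : Type*} [AddCommGroup V]

theorem affPerm_add {f : Perm V} (hf : f ∈ affPerm V) (x y : V) :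
    f (x + y) = f x + f y - f 0 := by
  have := hf x 0 y
  rw [sub_zero] at this
  rw [this]; abel

variable (p : ℕ) [Module (ZMod p) V]

/-- The linear part of an affine permutation. -/
def linPart (f : Perm V) (hf : f ∈ affPerm V) : V →ₗ[ZMod p] V :=
  AddMonoidHom.toZModLinearMap p
    { toFun := fun x => f x - f 0
      map_zero' := sub_self _
      map_add' := fun x y => by rw [affPerm_add hf]; abel }

@[simp]
theorem linPart_apply (f : Perm V) (hf : f ∈ affPerm V) (x : V) :
    linPart p f hf x = f x - f 0 := rfl

/-- No nonzero linear functional is constant on `D`, that is, `D` affinely spans `V`. -/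
def Spans (D : Set V) : Prop :=
  ∀ φ : V →ₗ[ZMod p] ZMod p, ∀ c, (∀ x ∈ D, φ x = c) → φ = 0

/-- Removing any one point of `D` leaves an affinely spanning set. -/
def CoSpans (D : Set V) : Prop :=
  ∀ d, Spans p (D \ {d})

variable {p}

theorem Spans.mono {D E : Set V} (hD : Spans p D) (h : D ⊆ E) : Spans p E :=
  fun φ c hc => hD φ c fun x hx => hc x (h hx)

theorem CoSpans.spans {D : Set V} (hD : CoSpans p D) : Spans p D :=
  (hD 0).mono Set.sdiff_subset

variable [Fact p.Prime]

theorem Spans.eq_of_eqOn {D : Set V} (hD : Spans p D) (hne : D.Nonempty) {f g : Perm V}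
    (hf : f ∈ affPerm V) (hg : g ∈ affPerm V) (h : ∀ x ∈ D, f x = g x) : f = g := by
  have hL : linPart p f hf - linPart p g hg = 0 := by
    apply LinearMap.ext
    intro x
    rw [← sub_eq_zero, ← Module.forall_dual_apply_eq_zero_iff (ZMod p)]
    intro φ
    have := hD (φ ∘ₗ (linPart p f hf - linPart p g hg)) (φ (g 0 - f 0)) fun y hy => by
      simp only [LinearMap.comp_apply, LinearMap.sub_apply, linPart_apply, h y hy]
      congr 1; abel
    have := LinearMap.congr_fun this x
    simpa using this
  obtain ⟨d, hd⟩ := hne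
  have h1 : ∀ x, f x - f 0 = g x - g 0 := fun x => by
    have := LinearMap.congr_fun hL x
    simpa [sub_eq_zero] using this
  have h0 : f 0 = g 0 := by
    have := h1 d
    rw [h d hd] at this
    exact (sub_right_inj.1 this)
  ext x
  have := h1 x
  rw [h0] at this
  exact sub_left_inj.1 this

/-- A set with more than `|V| / p` elements spans. -/
theorem spans_of_card_lt [Finite V] {D : Set V} (h : Nat.card V < p * D.ncard) : Spans p D := by
  intro φ c hc
  by_contra hφ
  have hsurj : Function.Surjective φ := LinearMap.surjective hφ
  have hcard : Nat.card V = Nat.card (LinearMap.ker φ) * p := by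
    rw [Submodule.card_eq_card_quotient_mul_card (LinearMap.ker φ),
      Nat.card_congr (LinearMap.quotKerEquivOfSurjective φ hsurj).toEquiv, Nat.card_zmod]
  have hle : D.ncard ≤ Nat.card (LinearMap.ker φ) := by
    rcases D.eq_empty_or_nonempty with rfl | ⟨d, hd⟩
    · simp
    · rw [← Nat.card_coe_set_eq]
      refine Nat.card_le_card_of_injective (fun x : D => (⟨x - d, ?_⟩ : LinearMap.ker φ)) ?_
      · rw [LinearMap.mem_ker, map_sub, hc x x.2, hc d hd, sub_self]
      · intro x y hxy
        have := congrArg Subtype.val hxy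
        exact Subtype.ext (sub_left_inj.1 this)
  rw [hcard, mul_comm _ p] at h
  exact absurd (Nat.lt_of_mul_lt_mul_left h) (not_lt.2 hle)

theorem coSpans_of_card_lt [Finite V] {D : Set V} (h : Nat.card V < p * (D.ncard - 1)) :
    CoSpans p D := by
  intro d
  apply spans_of_card_lt
  refine h.trans_le (Nat.mul_le_mul_left _ ?_)
  exact Set.pred_ncard_le_ncard_sdiff_singleton D d

end Affine

/-! ### Extending sets by one dimension -/

section Extend

variable {p : ℕ} [Fact p.Prime] {V : Type*} [AddCommGroup V] [Module (ZMod p) V]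

variable (p) in
/-- The copy of `D` in the hyperplane `V × {0}`. -/
def flat (D : Set V) : Set (V × ZMod p) := {x | x.2 = 0 ∧ x.1 ∈ D}

variable (p) in
/-- The copy of `D` in the hyperplane `V × {0}` together with the point `(0, 1)`. -/
def adjoin (D : Set V) : Set (V × ZMod p) := {x | (x.2 = 0 ∧ x.1 ∈ D) ∨ x = (0, 1)}

theorem ncard_flat {V : Type*} (D : Set V) : (flat p D).ncard = D.ncard := by
  have : flat p D = (fun v => (v, (0 : ZMod p))) '' D := by
    ext ⟨v, t⟩
    simp only [flat, Set.mem_ofPred_eq, Set.mem_image, Prod.mk.injEq]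
    constructor
    · rintro ⟨rfl, h⟩; exact ⟨v, h, rfl, rfl⟩
    · rintro ⟨w, h, rfl, rfl⟩; exact ⟨rfl, h⟩
  rw [this, Set.ncard_image_of_injective _ fun a b h => congrArg Prod.fst h]

theorem ncard_adjoin {V : Type*} [AddCommGroup V] [Finite V] (D : Set V) :
    (adjoin p D).ncard = D.ncard + 1 := by
  have : adjoin p D = insert (0, 1) (flat p D) := by
    ext x
    simp [adjoin, flat, or_comm]
  have : Finite (V × ZMod p) := inferInstance
  rw [‹adjoin p D = _›, Set.ncard_insert_of_notMem (by simp [flat]), ncard_flat]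

theorem linearMap_prod_eq_zero {φ : V × ZMod p →ₗ[ZMod p] ZMod p} (h : ∀ v, φ (v, 0) = 0)
    (h1 : φ (0, 1) = 0) : φ = 0 := by
  apply LinearMap.prod_ext
  · ext v; simpa using h v
  · apply LinearMap.ext_ring; simpa using h1

theorem eq_of_eq_on_hyperplane {f g : Perm (V × ZMod p)} (hf : f ∈ affPerm (V × ZMod p))
    (hg : g ∈ affPerm (V × ZMod p)) (h : ∀ v, f (v, 0) = g (v, 0)) (h1 : f (0, 1) = g (0, 1)) :
    f = g := by
  refine Spans.eq_of_eqOn (p := p) (D := {x | x.2 = 0 ∨ x = (0, 1)}) ?_ ⟨0, Or.inl rfl⟩ hf hg ?_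
  · intro φ c hc
    have h0 := hc 0 (Or.inl rfl)
    rw [map_zero] at h0
    exact linearMap_prod_eq_zero (fun v => (hc _ (Or.inl rfl)).trans h0.symm)
      ((hc _ (Or.inr rfl)).trans h0.symm)
  · rintro ⟨v, t⟩ (rfl | hx)
    · exact h v
    · rw [hx, h1]

theorem snd_eq_zero_of_spans {D : Set V} (hD : Spans p D) (hne : D.Nonempty)
    {f : Perm (V × ZMod p)} (hf : f ∈ affPerm (V × ZMod p))
    (h : ∀ d ∈ D, (f (d, 0)).2 = 0) (v : V) : (f (v, 0)).2 = 0 := by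
  have key := hD (LinearMap.snd _ _ _ ∘ₗ linPart p f hf ∘ₗ LinearMap.inl _ _ _) (0 - (f 0).2)
    fun x hx => by simp [h x hx]
  have h' : ∀ v, (f (v, 0)).2 = (f 0).2 := fun v => by
    have := LinearMap.congr_fun key v
    simpa [sub_eq_zero] using this
  obtain ⟨d, hd⟩ := hne
  rw [h', ← h' d, h d hd]

theorem exists_restrict {V : Type*} [AddCommGroup V] {f : Perm (V × ZMod p)} (hf : f ∈ affPerm (V × ZMod p))
    (h : ∀ v, (f (v, 0)).2 = 0) (h' : ∀ v, (f⁻¹ (v, 0)).2 = 0) :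
    ∃ r ∈ affPerm V, ∀ (n : ℕ) (v : V), (f ^ n) (v, 0) = ((r ^ n) v, 0) := by
  have e : ∀ v, f (v, 0) = ((f (v, 0)).1, 0) := fun v => Prod.ext rfl (h v)
  have e' : ∀ v, f⁻¹ (v, 0) = ((f⁻¹ (v, 0)).1, 0) := fun v => Prod.ext rfl (h' v)
  let r : Perm V :=
    { toFun := fun v => (f (v, 0)).1
      invFun := fun v => (f⁻¹ (v, 0)).1
      left_inv := fun v => by
        simp only
        rw [← e, show ∀ x, f⁻¹ (f x) = x from f.symm_apply_apply]
      right_inv := fun v => by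
        simp only
        rw [← e', show ∀ x, f (f⁻¹ x) = x from f.apply_symm_apply] }
  refine ⟨r, fun x y z => ?_, fun n => ?_⟩
  · have := hf (x, 0) (y, 0) (z, 0)
    simp only [Prod.mk_sub_mk, Prod.mk_add_mk, sub_zero, add_zero] at this
    exact congrArg Prod.fst this
  · induction n with
    | zero => intro v; rfl
    | succ n ih => intro v; rw [pow_succ, Perm.mul_apply, e, ih, pow_succ, Perm.mul_apply]; rfl

theorem inv_mem_permStab {α : Type*} {P : Subgroup (Perm α)} {D : Set α} {f : Perm α}
    (hf : f ∈ permStab P D) : f⁻¹ ∈ permStab (P : Set (Perm α)) D :=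
  ⟨P.inv_mem hf.1, fun x => by rw [← hf.2, show ∀ x, f (f⁻¹ x) = x from f.apply_symm_apply]⟩

theorem sq_eq_one_of_fixes_hyperplane {V : Type*} [AddCommGroup V] [Module (ZMod 2) V]
    {g : Perm (V × ZMod 2)} (hg : g ∈ affPerm (V × ZMod 2)) (hfix : ∀ v, g (v, 0) = (v, 0)) :
    g ^ 2 = 1 := by
  refine eq_of_eq_on_hyperplane (Subgroup.pow_mem _ hg 2) (Subgroup.one_mem _)
    (fun v => by rw [pow_two, Perm.mul_apply, hfix, hfix, Perm.one_apply]) ?_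
  rw [pow_two, Perm.mul_apply, Perm.one_apply]
  have hb : (g (0, 1)).2 = 1 := by
    by_contra hb
    have hb : (g (0, 1)).2 = 0 := by
      generalize (g (0, 1)).2 = t at hb
      revert t; decide
    have : g (0, 1) = g ((g (0, 1)).1, 0) := by rw [hfix]; exact Prod.ext rfl hb
    have := congrArg Prod.snd (g.injective this)
    exact one_ne_zero this
  have ha : g (0, 1) = ((g (0, 1)).1, 0) + (0, 1) := by ext <;> simp [hb]
  rw [ha, affPerm_add hg, hfix, ha]
  have : g 0 = 0 := hfix 0
  rw [this]
  ext <;> simp [ZModModule.add_self]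

theorem twoElements_flat {V : Type*} [AddCommGroup V] [Module (ZMod 2) V] {D : Set V}
    (hD : Spans 2 D) (hne : D.Nonempty) (h : TwoElements (permStab (affPerm V) D)) :
    TwoElements (permStab (affPerm (V × ZMod 2)) (flat 2 D)) := by
  have hsnd : ∀ f ∈ permStab (affPerm (V × ZMod 2)) (flat 2 D), ∀ v, (f (v, 0)).2 = 0 :=
    fun f hf => snd_eq_zero_of_spans hD hne hf.1 fun d hd => ((hf.2 (d, 0)).2 ⟨rfl, hd⟩).1
  intro f hf
  obtain ⟨r, hr, hfr⟩ := exists_restrict hf.1 (hsnd f hf) (hsnd _ (inv_mem_permStab hf))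
  obtain ⟨m, hm⟩ := h r ⟨hr, fun x => by
    have := hf.2 (x, 0)
    rw [← pow_one f, hfr] at this
    simpa [flat] using this⟩
  have hfix : ∀ v, (f ^ 2 ^ m) (v, 0) = (v, 0) := fun v => by rw [hfr, hm, Perm.one_apply]
  have hg : f ^ 2 ^ m ∈ affPerm (V × ZMod 2) := Subgroup.pow_mem _ hf.1 _
  exact ⟨m + 1, by rw [pow_succ, pow_mul, sq_eq_one_of_fixes_hyperplane hg hfix]⟩

theorem twoElements_adjoin {D : Set V} (hD : CoSpans p D) (hnt : D.Nontrivial)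
    (h : TwoElements (permStab (affPerm V) D)) :
    TwoElements (permStab (affPerm (V × ZMod p)) (adjoin p D)) := by
  have hfix : ∀ f ∈ permStab (affPerm (V × ZMod p)) (adjoin p D), f (0, 1) = (0, 1) := by
    intro f hf
    rcases (hf.2 (0, 1)).2 (Or.inr rfl) with hx | hx
    · exfalso
      have hg := inv_mem_permStab hf
      set g := f⁻¹ with hgdef
      have hne : ∀ x ∈ adjoin p D, x ≠ f (0, 1) → (g x).2 = 0 := by
        intro x hx hxe
        rcases (hg.2 x).2 hx with h1 | h1
        · exact h1.1
        · exact absurd (by rw [← h1, hgdef, show ∀ x, f (f⁻¹ x) = x from f.apply_symm_apply]) hxe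
      have h0 : ∀ v, (g (v, 0)).2 = 0 := by
        refine snd_eq_zero_of_spans (hD (f (0, 1)).1) ?_ hg.1 fun d hd => ?_
        · obtain ⟨d, hd, hne⟩ := hnt.exists_ne (f (0, 1)).1
          exact ⟨d, hd, hne⟩
        · exact hne _ (Or.inl ⟨rfl, hd.1⟩) fun h => hd.2 (congrArg Prod.fst h)
      have h1 : (g (0, 1)).2 = 0 := hne _ (Or.inr rfl) fun h => by
        rw [← h] at hx
        exact one_ne_zero hx.1
      have key := linearMap_prod_eq_zero (φ := LinearMap.snd _ _ _ ∘ₗ linPart p g hg.1)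
        (fun v => by
          have := h0 0
          simp [h0 v, show (g 0).2 = 0 from this])
        (by
          have := h0 0
          simp [h1, show (g 0).2 = 0 from this])
      have := LinearMap.congr_fun key (f (0, 1))
      have h00 : (g 0).2 = 0 := h0 0
      have hgf : g (f (0, 1)) = (0, 1) := f.symm_apply_apply _
      simp [hgf, h00] at this
    · exact hx
  have hsnd : ∀ f ∈ permStab (affPerm (V × ZMod p)) (adjoin p D), ∀ v, (f (v, 0)).2 = 0 := by
    intro f hf
    refine snd_eq_zero_of_spans hD.spans hnt.nonempty hf.1 fun d hd => ?_
    rcases (hf.2 (d, 0)).2 (Or.inl ⟨rfl, hd⟩) with h1 | h1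
    · exact h1.1
    · rw [← hfix f hf] at h1
      have := congrArg Prod.snd (f.injective h1)
      simp at this
  intro f hf
  obtain ⟨r, hr, hfr⟩ := exists_restrict hf.1 (hsnd f hf) (hsnd _ (inv_mem_permStab hf))
  obtain ⟨m, hm⟩ := h r ⟨hr, fun x => by
    have := hf.2 (x, 0)
    rw [← pow_one f, hfr] at this
    simpa [adjoin] using this⟩
  refine ⟨m, eq_of_eq_on_hyperplane (Subgroup.pow_mem _ hf.1 _) (Subgroup.one_mem _)
    (fun v => by rw [hfr, hm]; rfl) ?_⟩
  have : ∀ n : ℕ, (f ^ n) (0, 1) = (0, 1) := by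
    intro n
    induction n with
    | zero => rfl
    | succ n ih => rw [pow_succ, Perm.mul_apply, hfix f hf, ih]
  rw [this, Perm.one_apply]

variable (p V) in
/-- `V` has an `m`-element subset that spans robustly and whose affine stabilizer has only
elements of 2-power order. -/
def HasRobust (m : ℕ) : Prop :=
  ∃ D : Set V, D.ncard = m ∧ 3 ≤ D.ncard ∧ 3 ≤ Dᶜ.ncard ∧ CoSpans p D ∧
    TwoElements (permStab (affPerm V) D)

variable (V) in
/-- `V` has an `m`-element subset whose affine stabilizer has the required structure. -/
def HasGood (m : ℕ) : Prop :=
  ∃ D : Set V, D.ncard = m ∧ ThreeByTwo (permStab (affPerm V) D)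

theorem HasRobust.hasGood {m : ℕ} (h : HasRobust p V m) : HasGood V m := by
  obtain ⟨D, hm, -, -, -, h2⟩ := h
  exact ⟨D, hm, h2.threeByTwo⟩

theorem HasRobust.hasGood_adjoin {m : ℕ} (h : HasRobust p V m) : HasGood (V × ZMod p) (m + 1) := by
  obtain ⟨D, rfl, h3, -, hc, h2⟩ := h
  have hfin := Set.finite_of_ncard_pos (by omega : 0 < D.ncard)
  have hnt : D.Nontrivial := (Set.one_lt_ncard hfin).1 (by omega) |> fun ⟨a, ha, b, hb, h⟩ =>
    ⟨a, ha, b, hb, h⟩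
  have : adjoin p D = insert (0, 1) (flat p D) := by
    ext x
    simp [adjoin, flat, or_comm]
  refine ⟨adjoin p D, ?_, (twoElements_adjoin hc hnt h2).threeByTwo⟩
  have hfl : (flat p D).Finite := Set.finite_of_ncard_pos (by rw [ncard_flat]; omega)
  rw [this, Set.ncard_insert_of_notMem (by simp [flat]) hfl, ncard_flat]

theorem HasRobust.hasGood_flat {V : Type*} [AddCommGroup V] [Module (ZMod 2) V] {m : ℕ}
    (h : HasRobust 2 V m) : HasGood (V × ZMod 2) m := by
  obtain ⟨D, rfl, h3, -, hc, h2⟩ := h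
  have hne : D.Nonempty := Set.nonempty_of_ncard_ne_zero (by omega)
  exact ⟨flat 2 D, ncard_flat D, (twoElements_flat hc.spans hne h2).threeByTwo⟩

theorem HasRobust.prod [Finite V] {m : ℕ} (h : HasRobust p V m) :
    HasRobust p (V × ZMod p) (p * Nat.card V - (m + 1)) := by
  obtain ⟨D, rfl, h3, h3', hc, h2⟩ := h
  have hnt : D.Nontrivial := (Set.one_lt_ncard D.toFinite).1 (by omega) |> fun ⟨a, ha, b, hb, h⟩ =>
    ⟨a, ha, b, hb, h⟩
  have hp := (Fact.out : p.Prime).two_le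
  have hcard : Nat.card (V × ZMod p) = p * Nat.card V := by
    rw [Nat.card_prod, Nat.card_zmod, mul_comm]
  have h1 := Set.ncard_add_ncard_compl D
  have h2p : 2 * Nat.card V ≤ p * Nat.card V := Nat.mul_le_mul_right _ hp
  have hn : (adjoin p D)ᶜ.ncard = p * Nat.card V - (D.ncard + 1) := by
    have := Set.ncard_add_ncard_compl (adjoin p D)
    rw [ncard_adjoin, hcard] at this
    omega
  refine ⟨(adjoin p D)ᶜ, hn, by omega, ?_, ?_, ?_⟩
  · rw [compl_compl, ncard_adjoin]; omega
  · apply coSpans_of_card_lt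
    rw [hn, hcard]
    refine Nat.mul_lt_mul_of_pos_left ?_ (by omega)
    omega
  · rw [permStab_compl]
    exact twoElements_adjoin hc hnt h2

end Extend

/-! ### Transport along linear equivalences -/

section Transport

variable {p : ℕ} {V W : Type*} [AddCommGroup V] [AddCommGroup W] [Module (ZMod p) V]
  [Module (ZMod p) W]

theorem permCongr_mem_affPerm (e : V ≃ₗ[ZMod p] W) {f : Perm W} (hf : f ∈ affPerm W) :
    e.toEquiv.symm.permCongrHom f ∈ affPerm V := by
  intro x y z
  have := hf (e x) (e y) (e z)
  apply e.injective
  simpa using this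

theorem permCongr_mem_permStab (e : V ≃ₗ[ZMod p] W) {D : Set V} {f : Perm W}
    (hf : f ∈ permStab (affPerm W) (e.symm ⁻¹' D)) :
    e.toEquiv.symm.permCongrHom f ∈ permStab (affPerm V : Set (Perm V)) D := by
  refine ⟨permCongr_mem_affPerm e hf.1, fun x => ?_⟩
  have := hf.2 (e x)
  simpa using this

theorem ncard_preimage_equiv (e : V ≃ₗ[ZMod p] W) (D : Set V) :
    (e.symm ⁻¹' D).ncard = D.ncard :=
  Set.ncard_preimage_of_injective_subset_range e.symm.injective
    fun x _ => e.symm.surjective x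

theorem TwoElements.transport (e : V ≃ₗ[ZMod p] W) {D : Set V}
    (h : TwoElements (permStab (affPerm V) D)) :
    TwoElements (permStab (affPerm W) (e.symm ⁻¹' D)) := by
  intro f hf
  obtain ⟨m, hm⟩ := h _ (permCongr_mem_permStab e hf)
  refine ⟨m, e.toEquiv.symm.permCongrHom.injective ?_⟩
  rw [map_pow, hm, map_one]

theorem HasGood.transport (e : V ≃ₗ[ZMod p] W) {m : ℕ} (h : HasGood V m) : HasGood W m := by
  obtain ⟨D, rfl, h1, h2⟩ := h
  refine ⟨e.symm ⁻¹' D, ncard_preimage_equiv e D, fun f hf g hg hf3 hg3 => ?_, fun f hf => ?_⟩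
  · apply e.toEquiv.symm.permCongrHom.injective
    rw [map_mul, map_mul]
    refine h1 _ (permCongr_mem_permStab e hf) _ (permCongr_mem_permStab e hg) ?_ ?_
    · rw [← map_pow, hf3, map_one]
    · rw [← map_pow, hg3, map_one]
  · obtain ⟨m, hm⟩ := h2 _ (permCongr_mem_permStab e hf)
    refine ⟨m, e.toEquiv.symm.permCongrHom.injective ?_⟩
    rw [map_pow, hm, map_one]

theorem HasRobust.transport [Fact p.Prime] (e : V ≃ₗ[ZMod p] W) {m : ℕ} (h : HasRobust p V m) :
    HasRobust p W m := by
  obtain ⟨D, rfl, h3, h3', hc, h2⟩ := h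
  refine ⟨e.symm ⁻¹' D, ncard_preimage_equiv e D, ?_, ?_, fun d φ c hφ => ?_, h2.transport e⟩
  · rwa [ncard_preimage_equiv]
  · rwa [← Set.preimage_compl, ncard_preimage_equiv]
  · have := hc (e.symm d) (φ ∘ₗ e.toLinearMap) c fun x hx => hφ (e x) ⟨by simpa using hx.1, ?_⟩
    · ext w
      simpa using LinearMap.congr_fun this (e.symm w)
    · intro h
      exact hx.2 (by simp [← show e x = d from h])

end Transport

/-! ### Small dimensions over fields of odd order -/

section Odd

variable {p : ℕ} [Fact p.Prime]

theorem eq_of_eq_zero_one {f g : Perm (ZMod p)} (hf : f ∈ affPerm (ZMod p))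
    (hg : g ∈ affPerm (ZMod p)) (h0 : f 0 = g 0) (h1 : f 1 = g 1) : f = g := by
  refine Spans.eq_of_eqOn (p := p) (D := {0, 1}) ?_ ⟨0, by simp⟩ hf hg ?_
  · intro φ c hc
    have h0 := hc 0 (by simp)
    have h1 := hc 1 (by simp)
    rw [map_zero] at h0
    exact LinearMap.ext_ring (by rw [h1, ← h0]; rfl)
  · rintro x (rfl | rfl)
    · exact h0
    · exact h1

theorem twoElements_line : TwoElements (permStab (affPerm (ZMod p)) ({0, 1} : Set (ZMod p))) :=
  twoElements_of_pair _ fun _ hf _ hg => eq_of_eq_zero_one hf hg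

theorem hasGood_line_two : HasGood (ZMod p) 2 :=
  ⟨{0, 1}, Set.ncard_pair zero_ne_one, twoElements_line.threeByTwo⟩

theorem two_ne_zero_of_odd (hp : p ≠ 2) : (2 : ZMod p) ≠ 0 := by
  have : ((2 : ℕ) : ZMod p) ≠ 0 := by
    rw [Ne, ZMod.natCast_eq_zero_iff, Nat.prime_dvd_prime_iff_eq Fact.out Nat.prime_two]
    exact hp
  exact_mod_cast this

theorem hasGood_line_three (hp : p ≠ 2) : HasGood (ZMod p) 3 := by
  have h2 : (2 : ZMod p) ≠ 0 := two_ne_zero_of_odd hp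
  have h21 : (2 : ZMod p) ≠ 1 := fun h => one_ne_zero (α := ZMod p) (by linear_combination h)
  have h : ({0, 1, 2} : Set (ZMod p)).ncard = 3 :=
    Set.ncard_eq_three.2 ⟨0, 1, 2, zero_ne_one, h2.symm, h21.symm, rfl⟩
  exact ⟨{0, 1, 2}, h, threeByTwo_of_ncard_le_three _ (Set.toFinite _) h.le
    fun f hf g hg hfg => eq_of_eq_zero_one hf hg (hfg 0 (by simp)) (hfg 1 (by simp))⟩

theorem HasGood.compl {V : Type*} [AddCommGroup V] [Finite V] {m : ℕ} (h : HasGood V m) :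
    HasGood V (Nat.card V - m) := by
  obtain ⟨D, rfl, h⟩ := h
  exact ⟨Dᶜ, Set.ncard_compl D, by rwa [permStab_compl]⟩

theorem hasGood_line_five : HasGood (ZMod 5) 1 := by
  have : Fact (Nat.Prime 5) := ⟨by norm_num⟩
  refine ⟨{0}, Set.ncard_singleton _, TwoElements.threeByTwo fun f hf => ⟨2, ?_⟩⟩
  have h0 : f 0 = 0 := (hf.2 0).2 rfl
  have hl : ∀ x, f x = x * f 1 := fun x => by
    have := (linPart 5 f hf.1).map_smul x 1
    simpa [h0] using this
  have h1 : f 1 ≠ 0 := fun h => one_ne_zero (α := ZMod 5) (f.injective (h.trans h0.symm))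
  have h4 : ∀ a : ZMod 5, a ≠ 0 → a ^ 4 = 1 := fun a ha => ZMod.pow_card_sub_one_eq_one ha
  ext x
  simp only [show 2 ^ 2 = 4 from rfl, pow_succ, pow_zero, Perm.mul_apply, Perm.one_apply, hl x,
    hl (x * f 1), hl (x * f 1 * f 1), hl (x * f 1 * f 1 * f 1)]
  have := h4 _ h1
  linear_combination x * this

theorem linearMap_plane_eq_zero {φ : ZMod p × ZMod p →ₗ[ZMod p] ZMod p} (h : φ (1, 0) = 0)
    (h' : φ (0, 1) = 0) : φ = 0 := by
  refine linearMap_prod_eq_zero (fun v => ?_) h'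
  have := φ.map_smul v (1, 0)
  simpa [h] using this

theorem spans_triangle : Spans p ({(0, 0), (1, 0), (0, 1)} : Set (ZMod p × ZMod p)) := by
  intro φ c hc
  have h0 := hc (0, 0) (by simp)
  have h1 := hc (1, 0) (by simp)
  have h2 := hc (0, 1) (by simp)
  have hz : φ (0, 0) = 0 := map_zero φ
  exact linearMap_plane_eq_zero (by rw [h1, ← h0, hz]) (by rw [h2, ← h0, hz])

theorem hasGood_plane_three : HasGood (ZMod p × ZMod p) 3 := by
  have h : ({(0, 0), (1, 0), (0, 1)} : Set (ZMod p × ZMod p)).ncard = 3 :=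
    Set.ncard_eq_three.2 ⟨(0, 0), (1, 0), (0, 1), by simp, by simp, by simp, rfl⟩
  exact ⟨_, h, threeByTwo_of_ncard_le_three _ (Set.toFinite _) h.le
    fun f hf g hg hfg => spans_triangle.eq_of_eqOn ⟨_, Or.inl rfl⟩ hf hg hfg⟩

variable (p) in
/-- The parallelogram in the affine plane. -/
def quadrangle : Set (ZMod p × ZMod p) := {(0, 0), (1, 0), (0, 1), (1, 1)}

theorem ncard_quadrangle : (quadrangle p).ncard = 4 := by
  have : quadrangle p = (({(0, 0), (1, 0), (0, 1), (1, 1)} : Finset (ZMod p × ZMod p)) : Set _) := by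
    simp [quadrangle]
  rw [this, Set.ncard_coe_finset, Finset.card_insert_of_notMem (by simp),
    Finset.card_insert_of_notMem (by simp), Finset.card_insert_of_notMem (by simp),
    Finset.card_singleton]

theorem coSpans_quadrangle : CoSpans p (quadrangle p) := by
  intro d φ c hc
  have ha : φ (1, 1) = φ (1, 0) + φ (0, 1) := by rw [← map_add]; simp
  have hz : φ (0, 0) = 0 := map_zero φ
  have h : ∀ x ∈ quadrangle p, x ≠ d → φ x = c := fun x hx hd => hc x ⟨hx, hd⟩
  have h00 := h (0, 0) (by simp [quadrangle])
  have h10 := h (1, 0) (by simp [quadrangle])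
  have h01 := h (0, 1) (by simp [quadrangle])
  have h11 := h (1, 1) (by simp [quadrangle])
  rw [hz] at h00
  rw [ha] at h11
  have n1 : ((0, 0) : ZMod p × ZMod p) ≠ (1, 0) := by simp
  have n2 : ((0, 0) : ZMod p × ZMod p) ≠ (0, 1) := by simp
  have n3 : ((0, 0) : ZMod p × ZMod p) ≠ (1, 1) := by simp
  have n4 : ((1, 0) : ZMod p × ZMod p) ≠ (0, 1) := by simp
  have n5 : ((1, 0) : ZMod p × ZMod p) ≠ (1, 1) := by simp
  have n6 : ((0, 1) : ZMod p × ZMod p) ≠ (1, 1) := by simp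
  have key : φ (1, 0) = 0 ∧ φ (0, 1) = 0 := by
    grind
  exact linearMap_plane_eq_zero key.1 key.2

theorem twoElements_quadrangle (hp : p ≠ 2) :
    TwoElements (permStab (affPerm (ZMod p × ZMod p)) (quadrangle p)) := by
  have h2 : (2 : ZMod p) ≠ 0 := two_ne_zero_of_odd hp
  have h21 : (2 : ZMod p) ≠ 1 := fun h => one_ne_zero (α := ZMod p) (by linear_combination h)
  have hm0 : (-1 : ZMod p) ≠ 0 := by simp
  have hm1 : (-1 : ZMod p) ≠ 1 := fun h => h2 (by linear_combination - h)
  intro f hf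
  refine ⟨2, Spans.eq_of_eqOn coSpans_quadrangle.spans ⟨(0, 0), by simp [quadrangle]⟩
    (Subgroup.pow_mem _ hf.1 _) (Subgroup.one_mem _) ?_⟩
  have e : f (1, 1) = f (1, 0) - f (0, 0) + f (0, 1) := by
    have := hf.1 (1, 0) (0, 0) (0, 1)
    simpa using this
  have m00 := (hf.2 (0, 0)).2 (by simp [quadrangle])
  have m10 := (hf.2 (1, 0)).2 (by simp [quadrangle])
  have m01 := (hf.2 (0, 1)).2 (by simp [quadrangle])
  have m11 := (hf.2 (1, 1)).2 (by simp [quadrangle])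
  have i1 : f (0, 0) ≠ f (1, 0) := fun h => by simpa using f.injective h
  have i2 : f (0, 0) ≠ f (0, 1) := fun h => by simpa using f.injective h
  have i3 : f (1, 0) ≠ f (0, 1) := fun h => by simpa using f.injective h
  rw [e] at m11
  simp only [quadrangle, Set.mem_insert_iff, Set.mem_singleton_iff] at m00 m10 m01 m11
  have key : ∀ x ∈ quadrangle p, f (f (f (f x))) = x := by
    simp only [quadrangle, Set.mem_insert_iff, Set.mem_singleton_iff, forall_eq_or_imp, forall_eq]
    rcases m00 with h | h | h | h <;> rcases m10 with h' | h' | h' | h' <;>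
    (try exact absurd (h.trans h'.symm) i1) <;>
    rcases m01 with h'' | h'' | h'' | h'' <;>
    (try exact absurd (h.trans h''.symm) i2) <;>
    (try exact absurd (h'.trans h''.symm) i3) <;>
    rw [h, h', h''] at m11 e <;>
    simp [h2, h21, hm0, hm1, one_add_one_eq_two] at m11 e <;>
    simp [h, h', h'', e]
  exact key

theorem ncard_compl_quadrangle : (quadrangle p)ᶜ.ncard = p ^ 2 - 4 := by
  rw [Set.ncard_compl, ncard_quadrangle, Nat.card_prod, Nat.card_zmod, pow_two]

theorem three_le_of_ne_two (hp : p ≠ 2) : 3 ≤ p := by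
  have := (Fact.out : p.Prime).two_le
  omega

theorem hasRobust_plane (hp : p ≠ 2) : HasRobust p (ZMod p × ZMod p) 4 := by
  have h3 := three_le_of_ne_two hp
  refine ⟨quadrangle p, ncard_quadrangle, by simp [ncard_quadrangle], ?_, coSpans_quadrangle,
    twoElements_quadrangle hp⟩
  rw [ncard_compl_quadrangle]
  have : 3 * 3 ≤ p * p := Nat.mul_le_mul h3 h3
  rw [pow_two]; omega

theorem hasRobust_plane_compl (hp : p ≠ 2) : HasRobust p (ZMod p × ZMod p) (p ^ 2 - 4) := by
  have h3 := three_le_of_ne_two hp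
  have hpp : 3 * p ≤ p * p := Nat.mul_le_mul_right p h3
  refine ⟨(quadrangle p)ᶜ, ncard_compl_quadrangle, ?_, ?_, ?_, ?_⟩
  · rw [ncard_compl_quadrangle, pow_two]; omega
  · rw [compl_compl, ncard_quadrangle]; norm_num
  · apply coSpans_of_card_lt
    rw [ncard_compl_quadrangle, Nat.card_prod, Nat.card_zmod, pow_two]
    exact Nat.mul_lt_mul_of_pos_left (by omega) (by omega)
  · rw [permStab_compl]
    exact twoElements_quadrangle hp

end Odd

/-! ### Two configurations in the affine space of dimension four over the field of two elements -/

section Cross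

section Link

variable {V : Type*} [AddCommGroup V] [DecidableEq V]

/-- The number of `z ∈ D` such that `x + y + z ∈ D`. -/
def link (D : Finset V) (x y : V) : ℕ := (D.filter fun z => x + y + z ∈ D).card

/-- The number of `y ∈ D` such that `link D x y = n`. -/
def linkDegree (D : Finset V) (n : ℕ) (x : V) : ℕ := (D.filter fun y => link D x y = n).card

theorem link_map [Module (ZMod 2) V] {D : Finset V} {f : Perm V}
    (hf : f ∈ permStab (affPerm V) (D : Set V)) (x y : V) : link D (f x) (f y) = link D x y := by
  have hD : ∀ x, f x ∈ D ↔ x ∈ D := hf.2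
  have hadd : ∀ z, f x + f y + f z = f (x + y + z) := fun z => by
    have := hf.1 x y z
    have h : ∀ a b : V, a - b = a + b := fun a b => by
      rw [sub_eq_add_neg, ZModModule.neg_eq_self]
    rw [h, h] at this
    exact this.symm
  symm
  refine Finset.card_equiv f fun z => ?_
  simp only [Finset.mem_filter, hadd, hD]

theorem linkDegree_map [Module (ZMod 2) V] {D : Finset V} {f : Perm V}
    (hf : f ∈ permStab (affPerm V) (D : Set V)) (n : ℕ) (x : V) :
    linkDegree D n (f x) = linkDegree D n x := by
  have hD : ∀ x, f x ∈ D ↔ x ∈ D := hf.2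
  symm
  refine Finset.card_equiv f fun z => ?_
  simp only [Finset.mem_filter, hD, link_map hf]

end Link

theorem apply_four_of_mates {α : Type*} (f : Perm α) (P : Finset α) (R : α → α → Prop)
    (hP : ∀ x ∈ P, f x ∈ P) (hR : ∀ x y, R (f x) (f y) ↔ R x y)
    (hsymm : ∀ x ∈ P, ∀ y ∈ P, R x y → R y x)
    (huniq : ∀ x ∈ P, ∀ y ∈ P, ∀ z ∈ P, R x y → R x z → y = z)
    (hcover : ∀ x ∈ P, ∀ y ∈ P, ∀ z ∈ P, z = x ∨ z = y ∨ x = y ∨ R x y ∨ R x z ∨ R y z)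
    (x : α) (hx : x ∈ P) : f (f (f (f x))) = x := by
  have h1 := hP x hx
  have h2 := hP _ h1
  have h3 := hP _ h2
  have h4 := hP _ h3
  rcases hcover x hx _ h1 _ h2 with h | h | h | h | h | h
  · rw [h, h]
  · have := f.injective h
    rw [this, this, this, this]
  · rw [← h, ← h, ← h, ← h]
  · have := huniq _ h1 _ h2 _ hx ((hR _ _).2 h) (hsymm _ hx _ h1 h)
    rw [this, this]
  · have h' : R (f (f x)) (f (f (f (f x)))) := (hR _ _).2 ((hR _ _).2 h)
    exact huniq _ h2 _ h4 _ hx h' (hsymm _ hx _ h2 h)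
  · have := huniq _ h1 _ h2 _ hx h (hsymm _ hx _ h1 ((hR _ _).1 h))
    rw [this, this]

/-- The affine space of dimension four over the field of two elements. -/
abbrev Space := (ZMod 2 × ZMod 2) × (ZMod 2 × ZMod 2)

/-- The union of two complementary planes. -/
def cross : Finset Space := Finset.univ.filter fun x => x.1 = 0 ∨ x.2 = 0

/-- The union of two complementary planes and one more point. -/
def crossPlus : Finset Space := insert ((1, 0), (1, 0)) cross

theorem card_cross : cross.card = 7 := by decide +kernel

theorem card_crossPlus : crossPlus.card = 8 := by decide +kernel

/-- The standard bilinear form. -/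
def dot (x y : Space) : ZMod 2 :=
  x.1.1 * y.1.1 + x.1.2 * y.1.2 + x.2.1 * y.2.1 + x.2.2 * y.2.2

theorem exists_linearMap_eq_dot (φ : Space →ₗ[ZMod 2] ZMod 2) : ∃ t, ∀ x, φ x = dot x t := by
  refine ⟨((φ ((1, 0), 0), φ ((0, 1), 0)), (φ (0, (1, 0)), φ (0, (0, 1)))), fun x => ?_⟩
  simp only [dot, ← smul_eq_mul, ← map_smul, ← map_add]
  congr 1
  ext <;> simp

set_option synthInstance.maxSize 1000 in
theorem coSpans_crossPlus : CoSpans 2 (crossPlus : Set Space) := by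
  have key : ∀ (d t : Space) (c : ZMod 2), (∀ x ∈ crossPlus, x ≠ d → dot x t = c) → t = 0 := by
    decide +kernel
  intro d φ c hφ
  obtain ⟨t, ht⟩ := exists_linearMap_eq_dot φ
  have := key d t c fun x hx hd => (ht x).symm.trans (hφ x ⟨hx, hd⟩)
  exact LinearMap.ext fun x => by simp [ht, this, dot]

theorem spans_cross : Spans 2 (cross : Set Space) := by
  have key : ∀ (t : Space) (c : ZMod 2), (∀ x ∈ cross, dot x t = c) → t = 0 := by
    decide +kernel
  intro φ c hφ
  obtain ⟨t, ht⟩ := exists_linearMap_eq_dot φ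
  have := key t c fun x hx => (ht x).symm.trans (hφ x hx)
  exact LinearMap.ext fun x => by simp [ht, this, dot]

set_option synthInstance.maxSize 1000 in
theorem twoElements_crossPlus : TwoElements (permStab (affPerm Space) (crossPlus : Set Space)) := by
  intro f hf
  have hD : ∀ x, f x ∈ crossPlus ↔ x ∈ crossPlus := hf.2
  refine ⟨2, Spans.eq_of_eqOn coSpans_crossPlus.spans ⟨0, by decide +kernel⟩
    (Subgroup.pow_mem _ hf.1 _) (Subgroup.one_mem _) fun x hx => ?_⟩
  change f (f (f (f x))) = x
  have hcase : ∀ x ∈ crossPlus, linkDegree crossPlus 6 x = 1 ∨ linkDegree crossPlus 6 x = 2 := by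
    decide +kernel
  rcases hcase x hx with h | h
  · refine apply_four_of_mates f (crossPlus.filter fun x => linkDegree crossPlus 6 x = 1)
      (fun x y => link crossPlus x y = 6) ?_ ?_ ?_ ?_ ?_ x
      (Finset.mem_filter.2 ⟨hx, h⟩)
    · exact fun x hx => by simpa [hD, linkDegree_map hf] using hx
    · exact fun x y => by rw [link_map hf]
    all_goals decide +kernel
  · refine apply_four_of_mates f (crossPlus.filter fun x => linkDegree crossPlus 6 x = 2)
      (fun x y => x ≠ y ∧ link crossPlus x y = 4) ?_ ?_ ?_ ?_ ?_ x
      (Finset.mem_filter.2 ⟨hx, h⟩)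
    · exact fun x hx => by simpa [hD, linkDegree_map hf] using hx
    · exact fun x y => by rw [link_map hf, f.injective.ne_iff]
    all_goals decide +kernel

theorem hasRobust_crossPlus : HasRobust 2 Space 8 := by
  have h8 : (crossPlus : Set Space).ncard = 8 := by rw [Set.ncard_coe_finset, card_crossPlus]
  refine ⟨crossPlus, h8, by omega, ?_, coSpans_crossPlus, twoElements_crossPlus⟩
  rw [Set.ncard_compl, h8, Nat.card_eq_fintype_card, show Fintype.card Space = 16 from rfl]
  norm_num

/-- The nonzero points of the two planes. -/
def arm (b : Bool) : Finset Space := cross.filter fun x => x ≠ 0 ∧ (x.1 = 0 ↔ b)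

theorem threeByTwo_cross : ThreeByTwo (permStab (affPerm Space) (cross : Set Space)) := by
  have hcross : ∀ x ∈ cross, x = 0 ∨ ∃ b, x ∈ arm b := by decide +kernel
  have hcard : ∀ b, (arm b).card = 3 := by decide +kernel
  have hsub : ∀ b, ∀ x ∈ arm b, x ∈ cross := by decide +kernel
  have hzero : ∀ x ∈ cross, x = 0 ↔ linkDegree cross 2 x = 0 := by decide +kernel
  have hlink : ∀ b, ∀ x ∈ arm b, ∀ y ∈ cross, link cross x y = 2 ↔ y ∈ arm !b := by decide +kernel
  have h0 : (0 : Space) ∈ cross := by decide +kernel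
  have hdisj : ∀ b, ∀ x ∈ arm b, ∀ b', x ∈ arm b' → b' = b := by decide +kernel
  have hzero' : ∀ b, (0 : Space) ∉ arm b := by decide +kernel
  have hfix : ∀ f ∈ permStab (affPerm Space) (cross : Set Space), f 0 = 0 := fun f hf => by
    rw [hzero _ ((hf.2 0).2 h0), linkDegree_map hf, ← hzero _ h0]
  have harm : ∀ f ∈ permStab (affPerm Space) (cross : Set Space), ∀ b, ∀ x ∈ arm b,
      ∃ b', f x ∈ arm b' := fun f hf b x hx => by
    refine (hcross _ ((hf.2 x).2 (hsub b x hx))).resolve_left fun h => hzero' b ?_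
    rwa [← f.injective (h.trans (hfix f hf).symm)]
  have hsq' : ∀ f ∈ permStab (affPerm Space) (cross : Set Space), ∀ b, ∀ x ∈ arm b,
      (f ^ 2) x ∈ arm b := fun f hf b x hx => by
    obtain ⟨b', h'⟩ := harm f hf b x hx
    obtain ⟨b'', h''⟩ := harm f hf b' _ h'
    have h1 := hlink b x hx (f x) (hsub _ _ h')
    have h2 := hlink b' _ h' (f (f x)) (hsub _ _ h'')
    rw [link_map hf, h1] at h2
    change f (f x) ∈ arm b
    by_cases hb : f x ∈ arm !b
    · have h3 := h2.1 hb
      rwa [hdisj _ _ hb _ h', Bool.not_not] at h3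
    · have h3 : b' = b := by
        by_contra hbb
        rw [Bool.eq_not_of_ne hbb] at h'
        exact hb h'
      have h4 : b'' = b' := by
        by_contra hbb
        rw [Bool.eq_not_of_ne hbb] at h''
        exact hb (h2.2 h'')
      rwa [h4, h3] at h''
  have hsq : ∀ f ∈ permStab (affPerm Space) (cross : Set Space), ∀ b, ∀ x,
      (f ^ 2) x ∈ arm b ↔ x ∈ arm b := fun f hf b x => by
    refine ⟨fun hx => ?_, hsq' f hf b x⟩
    have h00 : (f ^ 2) 0 = 0 := by rw [pow_two, Perm.mul_apply, hfix f hf, hfix f hf]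
    rcases hcross x (((pow_mem_iff hf.2 2) x).1 (hsub _ _ hx)) with rfl | ⟨b', hb'⟩
    · rwa [h00] at hx
    · rwa [hdisj _ _ (hsq' f hf b' x hb') _ hx]
  have hcommute : ∀ f ∈ permStab (affPerm Space) (cross : Set Space), f ^ 3 = 1 → ∀ b, ∀ x,
      f x ∈ arm b ↔ x ∈ arm b := fun f hf h3 b x => by
    have h4 : f = (f ^ 2) ^ 2 := by rw [← pow_mul, pow_succ, h3, one_mul]
    rw [h4, pow_two, Perm.mul_apply, hsq f hf, hsq f hf]
  have hext : ∀ f ∈ affPerm Space, ∀ g ∈ affPerm Space, f 0 = g 0 →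
      (∀ b, ∀ x ∈ arm b, f x = g x) → f = g := fun f hf g hg h h' => by
    refine spans_cross.eq_of_eqOn ⟨0, h0⟩ hf hg fun x hx => ?_
    rcases hcross x hx with rfl | ⟨b, hb⟩
    · exact h
    · exact h' b x hb
  have hnc : ∀ b, (arm b : Set Space).ncard ≤ 3 := fun b => by rw [Set.ncard_coe_finset, hcard]
  refine ⟨fun f hf g hg hf3 hg3 => ?_, fun f hf => ⟨2, ?_⟩⟩
  · refine hext _ (Subgroup.mul_mem _ hf.1 hg.1) _ (Subgroup.mul_mem _ hg.1 hf.1) ?_ fun b => ?_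
    · simp only [Perm.mul_apply, hfix f hf, hfix g hg]
    · exact commute_on_of_ncard_le_three (Set.toFinite _) (hnc b) (hcommute f hf hf3 b)
        (hcommute g hg hg3 b) hf3 hg3
  · rw [show 3 * 2 ^ 2 = 2 * 6 from rfl, pow_mul]
    refine hext _ (Subgroup.pow_mem _ (Subgroup.pow_mem _ hf.1 _) _) _ (Subgroup.one_mem _) ?_
      fun b => ?_
    · simp only [pow_succ, pow_zero, one_mul, Perm.mul_apply, hfix f hf, Perm.one_apply]
    · exact pow_six_on_of_ncard_le_three (Set.toFinite _) (hnc b) (hsq f hf b)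

theorem hasGood_cross : HasGood Space 7 :=
  ⟨cross, by rw [Set.ncard_coe_finset, card_cross], threeByTwo_cross⟩

end Cross

/-! ### Colourings -/

section Colour

/-- The sum of the values of the standard character of `ZMod 3` over a colouring. -/
noncomputable def colourSum {α : Type*} [Fintype α] (c : α → ZMod 3) : ℂ :=
  ∑ x, ZMod.stdAddChar (c x)

/-- The elements of `P` preserving the colouring `c`. -/
def colourStab {α : Type*} (P : Set (Perm α)) (c : α → ZMod 3) : Set (Perm α) :=
  {f | f ∈ P ∧ ∀ x, c (f x) = c x}

/-- There is a colouring of `α` with nonzero character sum whose stabilizer in `P` has only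
elements of 2-power order. -/
def HasColouring {α : Type*} [Fintype α] (P : Set (Perm α)) : Prop :=
  ∃ c : α → ZMod 3, colourSum c ≠ 0 ∧ TwoElements (colourStab P c)

theorem stdAddChar_one_pow_three : (ZMod.stdAddChar (1 : ZMod 3) : ℂ) ^ 3 = 1 := by
  rw [← AddChar.map_nsmul_eq_pow, show 3 • (1 : ZMod 3) = 0 from rfl, AddChar.map_zero_eq_one]

theorem stdAddChar_one_ne_one : (ZMod.stdAddChar (1 : ZMod 3) : ℂ) ≠ 1 := fun h => by
  rw [← AddChar.map_zero_eq_one (ZMod.stdAddChar (N := 3))] at h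
  exact one_ne_zero (ZMod.injective_stdAddChar h)

theorem stdAddChar_two : (ZMod.stdAddChar (2 : ZMod 3) : ℂ) = ZMod.stdAddChar (1 : ZMod 3) ^ 2 := by
  rw [← AddChar.map_nsmul_eq_pow]; rfl

theorem hasColouring_of_twoElements {α : Type*} [Fintype α] [Nonempty α] {P : Set (Perm α)}
    {D : Set α} (h : TwoElements (permStab P D)) : HasColouring P := by
  classical
  refine ⟨fun x => if x ∈ D then 1 else 0, fun h0 => ?_, h.mono ?_⟩
  · have hsum : colourSum (fun x => if x ∈ D then (1 : ZMod 3) else 0) =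
        (Finset.univ.filter (· ∈ D)).card * ZMod.stdAddChar (1 : ZMod 3) +
          (Finset.univ.filter (· ∉ D)).card := by
      simp only [colourSum, apply_ite ZMod.stdAddChar, Finset.sum_ite, Finset.sum_const,
        AddChar.map_zero_eq_one, nsmul_eq_mul, mul_one]
    have hcard := Finset.card_filter_add_card_filter_not (s := (Finset.univ : Finset α)) (· ∈ D)
    have hpos : 0 < (Finset.univ : Finset α).card := Finset.card_pos.2 Finset.univ_nonempty
    rw [hsum] at h0
    generalize (Finset.univ.filter (· ∈ D)).card = a at *
    generalize (Finset.univ.filter (· ∉ D)).card = b at *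
    have h3 := stdAddChar_one_pow_three
    generalize (ZMod.stdAddChar (1 : ZMod 3) : ℂ) = w at *
    have : ((a ^ 3 + b ^ 3 : ℕ) : ℂ) = 0 := by
      push_cast
      linear_combination (a ^ 2 * w ^ 2 - a * w * b + b ^ 2) * h0 - a ^ 3 * h3
    rw [Nat.cast_eq_zero] at this
    have ha : a = 0 := by
      have : a ^ 3 = 0 := by omega
      exact pow_eq_zero_iff (by norm_num) |>.1 this
    have hb : b = 0 := by
      have : b ^ 3 = 0 := by omega
      exact pow_eq_zero_iff (by norm_num) |>.1 this
    omega
  · rintro f ⟨hf, hc⟩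
    refine ⟨hf, fun x => ?_⟩
    have := hc x
    by_cases h1 : x ∈ D <;> by_cases h2 : f x ∈ D <;> simp_all

theorem HasColouring.transport {p : ℕ} {V W : Type*} [AddCommGroup V] [AddCommGroup W]
    [Module (ZMod p) V] [Module (ZMod p) W] [Fintype V] [Fintype W] (e : V ≃ₗ[ZMod p] W)
    (h : HasColouring (affPerm V : Set (Perm V))) : HasColouring (affPerm W : Set (Perm W)) := by
  obtain ⟨c, hc, h2⟩ := h
  refine ⟨fun x => c (e.symm x), fun h0 => hc ?_, fun f hf => ?_⟩
  · rw [← h0]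
    exact Fintype.sum_equiv e.toEquiv _ _ fun x => by simp
  · obtain ⟨m, hm⟩ := h2 _ ⟨permCongr_mem_affPerm e hf.1, fun x => by
      simpa using hf.2 (e x)⟩
    refine ⟨m, e.toEquiv.symm.permCongrHom.injective ?_⟩
    rw [map_pow, hm, map_one]

/-- The colouring of the affine space of order eight. -/
def octetColour (x : (ZMod 2 × ZMod 2) × ZMod 2) : ZMod 3 :=
  if x = ((0, 0), 0) ∨ x = ((1, 0), 0) then 0 else if x = ((0, 1), 0) then 1 else 2

theorem hasColouring_octet :
    HasColouring (affPerm ((ZMod 2 × ZMod 2) × ZMod 2) : Set (Perm ((ZMod 2 × ZMod 2) × ZMod 2))) := by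
  refine ⟨octetColour, fun h0 => ?_, fun f hf => ⟨2, ?_⟩⟩
  · have hsum : colourSum octetColour = 2 + ZMod.stdAddChar (1 : ZMod 3) +
        5 * ZMod.stdAddChar (2 : ZMod 3) := by
      rw [colourSum, Finset.sum_comp (ZMod.stdAddChar (N := 3)) octetColour,
        show Finset.univ.image octetColour = {0, 1, 2} by decide +kernel,
        Finset.sum_insert (by decide), Finset.sum_insert (by decide), Finset.sum_singleton,
        show ({x | octetColour x = 0} : Finset _).card = 2 by decide +kernel,
        show ({x | octetColour x = 1} : Finset _).card = 1 by decide +kernel,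
        show ({x | octetColour x = 2} : Finset _).card = 5 by decide +kernel]
      simp [add_assoc]
    rw [hsum, stdAddChar_two] at h0
    have h3 := stdAddChar_one_pow_three
    have h1 := stdAddChar_one_ne_one
    generalize (ZMod.stdAddChar (1 : ZMod 3) : ℂ) = w at *
    have hw : w ^ 2 + w + 1 = 0 := by
      have : (w - 1) * (w ^ 2 + w + 1) = 0 := by linear_combination h3
      exact (mul_eq_zero.1 this).resolve_left (sub_ne_zero.2 h1)
    have h4 : 1 + 4 * w ^ 2 = 0 := by linear_combination h0 - hw
    have : (65 : ℂ) = 0 := by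
      linear_combination (16 * w ^ 4 - 4 * w ^ 2 + 1) * h4 - 64 * (w ^ 3 + 1) * h3
    norm_num at this
  · have hc0 : ∀ x, octetColour x = 0 ↔ x = ((0, 0), 0) ∨ x = ((1, 0), 0) := by decide +kernel
    have hc1 : ∀ x, octetColour x = 1 ↔ x = ((0, 1), 0) := by decide +kernel
    have h01 : f ((0, 1), 0) = ((0, 1), 0) := (hc1 _).1 (by rw [hf.2]; rfl)
    have h00 : f ((0, 0), 0) = ((0, 0), 0) ∨ f ((0, 0), 0) = ((1, 0), 0) :=
      (hc0 _).1 (by rw [hf.2]; rfl)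
    have h10 : f ((1, 0), 0) = ((0, 0), 0) ∨ f ((1, 0), 0) = ((1, 0), 0) :=
      (hc0 _).1 (by rw [hf.2]; rfl)
    have hne : f ((0, 0), 0) ≠ f ((1, 0), 0) := fun h => by simpa using f.injective h
    have hg : f ^ 2 ∈ affPerm _ := Subgroup.pow_mem _ hf.1 2
    have g01 : (f ^ 2) ((0, 1), 0) = ((0, 1), 0) := by
      rw [pow_two, Perm.mul_apply, h01, h01]
    have g00 : (f ^ 2) 0 = 0 := by
      change f (f ((0, 0), 0)) = ((0, 0), 0)
      grind
    have g10 : (f ^ 2) ((1, 0), 0) = ((1, 0), 0) := by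
      change f (f ((1, 0), 0)) = ((1, 0), 0)
      grind
    have g11 : (f ^ 2) ((1, 1), 0) = ((1, 1), 0) := by
      rw [show (((1, 1), 0) : (ZMod 2 × ZMod 2) × ZMod 2) = ((1, 0), 0) + ((0, 1), 0) from rfl,
        affPerm_add hg, g10, g01, g00, sub_zero]
    have hall : ∀ v : ZMod 2 × ZMod 2, v = 0 ∨ v = (1, 0) ∨ v = (0, 1) ∨ v = (1, 1) := by decide
    rw [show 2 ^ 2 = 2 * 2 from rfl, pow_mul]
    refine sq_eq_one_of_fixes_hyperplane hg fun v => ?_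
    rcases hall v with rfl | rfl | rfl | rfl
    · exact g00
    · exact g10
    · exact g01
    · exact g11

end Colour

/-! ### Affine groups of arbitrary dimension -/

section Dimension

/-- `V` has two sets of different sizes, neither larger than half of `V`, whose affine stabilizers
have the required structure. -/
def HasTwoSizes (V : Type*) [AddCommGroup V] : Prop :=
  ∃ m n, m < n ∧ 2 * n ≤ Nat.card V ∧ HasGood V m ∧ HasGood V n

theorem HasTwoSizes.transport {p : ℕ} {V W : Type*} [AddCommGroup V] [AddCommGroup W]
    [Module (ZMod p) V] [Module (ZMod p) W] (e : V ≃ₗ[ZMod p] W) (h : HasTwoSizes V) :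
    HasTwoSizes W := by
  obtain ⟨m, n, hmn, hn, h1, h2⟩ := h
  exact ⟨m, n, hmn, by rwa [← Nat.card_congr e.toEquiv], h1.transport e, h2.transport e⟩

theorem hasTwoSizes_of_ne {V : Type*} [AddCommGroup V] [Finite V] {m n : ℕ} (hmn : m < n)
    (hn : m + n ≠ Nat.card V) (hm : HasGood V m) (hn' : HasGood V n) : HasTwoSizes V := by
  have hle : ∀ {k}, HasGood V k → k ≤ Nat.card V := fun ⟨D, h, _⟩ => h ▸ Set.ncard_le_card D
  have hm1 := hle hm
  have hn1 := hle hn'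
  by_cases h1 : 2 * n ≤ Nat.card V
  · exact ⟨m, n, hmn, h1, hm, hn'⟩
  · by_cases h2 : 2 * m ≤ Nat.card V
    · rcases lt_or_gt_of_ne hn with h | h
      · exact ⟨m, _, by omega, by omega, hm, hn'.compl⟩
      · exact ⟨_, m, by omega, h2, hn'.compl, hm⟩
    · exact ⟨_, _, by omega, by omega, hn'.compl, hm.compl⟩

variable {p : ℕ} [Fact p.Prime]

theorem nonempty_linearEquiv (V W : Type*) [AddCommGroup V] [AddCommGroup W] [Module (ZMod p) V]
    [Module (ZMod p) W] [Finite V] [Finite W]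
    (h : Module.finrank (ZMod p) V = Module.finrank (ZMod p) W) : Nonempty (V ≃ₗ[ZMod p] W) :=
  ⟨LinearEquiv.ofFinrankEq V W h⟩

theorem HasRobust.fin_succ {k m : ℕ} (h : HasRobust p (Fin k → ZMod p) m) :
    HasRobust p (Fin (k + 1) → ZMod p) (p ^ (k + 1) - (m + 1)) := by
  obtain ⟨e⟩ := nonempty_linearEquiv (p := p) ((Fin k → ZMod p) × ZMod p)
    (Fin (k + 1) → ZMod p) (by simp)
  have := h.prod.transport e
  rwa [Nat.card_fun, Nat.card_fin, Nat.card_zmod, ← pow_succ'] at this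

theorem HasRobust.le {V : Type*} [AddCommGroup V] [Module (ZMod p) V] [Finite V] {m : ℕ}
    (h : HasRobust p V m) : m + 3 ≤ Nat.card V := by
  obtain ⟨D, rfl, -, h, -⟩ := h
  have := Set.ncard_add_ncard_compl D
  omega

theorem exists_hasRobust_odd (hp : p ≠ 2) (k : ℕ) : ∃ m n, m < n ∧
    HasRobust p (Fin (k + 2) → ZMod p) m ∧ HasRobust p (Fin (k + 2) → ZMod p) n := by
  induction k with
  | zero =>
    obtain ⟨e⟩ := nonempty_linearEquiv (p := p) (ZMod p × ZMod p) (Fin (0 + 2) → ZMod p) (by simp)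
    have h3 := three_le_of_ne_two hp
    have hpp : 3 * 3 ≤ p * p := Nat.mul_le_mul h3 h3
    have h1 := (hasRobust_plane hp).transport e
    have h2 := (hasRobust_plane_compl hp).transport e
    exact ⟨4, p ^ 2 - 4, by rw [pow_two]; omega, h1, h2⟩
  | succ k ih =>
    obtain ⟨m, n, hmn, hm, hn⟩ := ih
    have h1 := hm.le
    have h2 := hn.le
    rw [Nat.card_fun, Nat.card_fin, Nat.card_zmod] at h1 h2
    have h3 : p ^ (k + 2) ≤ p ^ (k + 2 + 1) := Nat.pow_le_pow_right (Fact.out : p.Prime).pos (by omega)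
    exact ⟨_, _, by omega, hn.fin_succ, hm.fin_succ⟩

theorem exists_hasRobust_two (k : ℕ) : ∃ m, HasRobust 2 (Fin (k + 4) → ZMod 2) m := by
  induction k with
  | zero =>
    obtain ⟨e⟩ := nonempty_linearEquiv (p := 2) Space (Fin (0 + 4) → ZMod 2) (by simp)
    exact ⟨8, hasRobust_crossPlus.transport e⟩
  | succ k ih =>
    obtain ⟨m, hm⟩ := ih
    exact ⟨_, hm.fin_succ⟩

theorem HasRobust.hasColouring {V : Type*} [AddCommGroup V] [Module (ZMod p) V] [Fintype V] {m : ℕ}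
    (h : HasRobust p V m) : HasColouring (affPerm V : Set (Perm V)) := by
  obtain ⟨D, -, -, -, -, h⟩ := h
  exact hasColouring_of_twoElements h

theorem HasRobust.fin_hasGood_succ {k m : ℕ} (h : HasRobust p (Fin k → ZMod p) m) :
    HasGood (Fin (k + 1) → ZMod p) (m + 1) := by
  obtain ⟨e⟩ := nonempty_linearEquiv (p := p) ((Fin k → ZMod p) × ZMod p)
    (Fin (k + 1) → ZMod p) (by simp)
  exact h.hasGood_adjoin.transport e

theorem perm_line_two : ∀ f : Perm (ZMod 2), f ^ 2 ^ 1 = 1 := by decide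

theorem perm_plane_two :
    ∀ f : Perm (ZMod 2 × ZMod 2), (∀ x, (f x = 0 ∨ f x = (1, 0)) ↔ x = 0 ∨ x = (1, 0)) →
      f ^ 2 ^ 1 = 1 := by
  decide +kernel

theorem twoElements_line_two (D : Set (ZMod 2)) : TwoElements (permStab (affPerm (ZMod 2)) D) :=
  fun f _ => ⟨1, perm_line_two f⟩

theorem twoElements_plane_two :
    TwoElements (permStab (affPerm (ZMod 2 × ZMod 2)) ({0, (1, 0)} : Set (ZMod 2 × ZMod 2))) :=
  fun f hf => ⟨1, perm_plane_two f hf.2⟩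

theorem hasColouring_fin_two (k : ℕ) :
    HasColouring (affPerm (Fin (k + 1) → ZMod 2) : Set (Perm (Fin (k + 1) → ZMod 2))) := by
  match k with
  | 0 =>
    obtain ⟨e⟩ := nonempty_linearEquiv (p := 2) (ZMod 2) (Fin (0 + 1) → ZMod 2) (by simp)
    exact (hasColouring_of_twoElements (twoElements_line_two ∅)).transport e
  | 1 =>
    obtain ⟨e⟩ := nonempty_linearEquiv (p := 2) (ZMod 2 × ZMod 2) (Fin (1 + 1) → ZMod 2) (by simp)
    exact (hasColouring_of_twoElements twoElements_plane_two).transport e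
  | 2 =>
    obtain ⟨e⟩ := nonempty_linearEquiv (p := 2) ((ZMod 2 × ZMod 2) × ZMod 2)
      (Fin (2 + 1) → ZMod 2) (by simp)
    exact hasColouring_octet.transport e
  | k + 3 => exact (exists_hasRobust_two k).choose_spec.hasColouring

theorem hasColouring_fin_odd (hp : p ≠ 2) (k : ℕ) :
    HasColouring (affPerm (Fin (k + 1) → ZMod p) : Set (Perm (Fin (k + 1) → ZMod p))) := by
  match k with
  | 0 =>
    obtain ⟨e⟩ := nonempty_linearEquiv (p := p) (ZMod p) (Fin (0 + 1) → ZMod p) (by simp)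
    exact (hasColouring_of_twoElements twoElements_line).transport e
  | k + 1 =>
    obtain ⟨m, n, -, h, -⟩ := exists_hasRobust_odd hp k
    exact h.hasColouring

theorem hasTwoSizes_fin_two (k : ℕ) (hk : k ≠ 2) : HasTwoSizes (Fin (k + 1) → ZMod 2) := by
  match k with
  | 0 =>
    obtain ⟨e⟩ := nonempty_linearEquiv (p := 2) (ZMod 2) (Fin (0 + 1) → ZMod 2) (by simp)
    refine HasTwoSizes.transport e ⟨0, 1, one_pos, by simp, ?_, ?_⟩
    · exact ⟨∅, Set.ncard_empty _, (twoElements_line_two _).threeByTwo⟩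
    · exact ⟨{0}, Set.ncard_singleton _, (twoElements_line_two _).threeByTwo⟩
  | 1 =>
    obtain ⟨e⟩ := nonempty_linearEquiv (p := 2) (ZMod 2 × ZMod 2) (Fin (1 + 1) → ZMod 2) (by simp)
    refine HasTwoSizes.transport e (hasTwoSizes_of_ne (m := 2) (n := 3) (by norm_num) (by simp) ?_
      hasGood_plane_three)
    exact ⟨{0, (1, 0)}, Set.ncard_pair (by decide), twoElements_plane_two.threeByTwo⟩
  | 2 => exact absurd rfl hk
  | 3 =>
    obtain ⟨e⟩ := nonempty_linearEquiv (p := 2) Space (Fin (3 + 1) → ZMod 2) (by simp)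
    exact HasTwoSizes.transport e
      ⟨7, 8, by norm_num, by simp, hasGood_cross, hasRobust_crossPlus.hasGood⟩
  | k + 4 =>
    obtain ⟨m, hm⟩ := exists_hasRobust_two k
    obtain ⟨e⟩ := nonempty_linearEquiv (p := 2) ((Fin (k + 4) → ZMod 2) × ZMod 2)
      (Fin (k + 4 + 1) → ZMod 2) (by simp)
    have h := hm.le
    refine HasTwoSizes.transport e ⟨m, m + 1, by omega, ?_, hm.hasGood_flat, hm.hasGood_adjoin⟩
    rw [Nat.card_prod, Nat.card_zmod]
    omega

theorem hasTwoSizes_fin_odd (hp : p ≠ 2) (k : ℕ) : HasTwoSizes (Fin (k + 1) → ZMod p) := by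
  match k with
  | 0 =>
    obtain ⟨e⟩ := nonempty_linearEquiv (p := p) (ZMod p) (Fin (0 + 1) → ZMod p) (by simp)
    refine HasTwoSizes.transport e ?_
    by_cases h5 : p = 5
    · subst h5
      exact hasTwoSizes_of_ne (by norm_num) (by simp) hasGood_line_five hasGood_line_two
    · exact hasTwoSizes_of_ne (by norm_num) (by rw [Nat.card_zmod]; exact Ne.symm h5)
        hasGood_line_two (hasGood_line_three hp)
  | 1 =>
    obtain ⟨e⟩ := nonempty_linearEquiv (p := p) (ZMod p × ZMod p) (Fin (1 + 1) → ZMod p) (by simp)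
    refine HasTwoSizes.transport e (hasTwoSizes_of_ne (by norm_num) ?_
      hasGood_plane_three (hasRobust_plane hp).hasGood)
    rw [Nat.card_prod, Nat.card_zmod]
    have h3 := three_le_of_ne_two hp
    have : 3 * 3 ≤ p * p := Nat.mul_le_mul h3 h3
    omega
  | k + 2 =>
    obtain ⟨m, n, hmn, hm, hn⟩ := exists_hasRobust_odd hp k
    have h1 := hm.le
    have h2 := hn.le
    refine hasTwoSizes_of_ne (by omega) ?_ hm.fin_hasGood_succ hn.fin_hasGood_succ
    rw [Nat.card_fun, Nat.card_fin, Nat.card_zmod] at *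
    have : 2 * p ^ (k + 2) ≤ p * p ^ (k + 2) := Nat.mul_le_mul_right _ (Fact.out : p.Prime).two_le
    rw [pow_succ' p (k + 2)]
    omega

theorem exists_linearEquiv_fin (p : ℕ) [Fact p.Prime] (V : Type*) [AddCommGroup V]
    [Module (ZMod p) V] [Finite V] [Nontrivial V] : ∃ k,
    Module.finrank (ZMod p) V = k + 1 ∧ Nonempty ((Fin (k + 1) → ZMod p) ≃ₗ[ZMod p] V) := by
  have := Module.finrank_pos (R := ZMod p) (M := V)
  obtain ⟨k, hk⟩ := Nat.exists_eq_add_of_lt this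
  rw [zero_add] at hk
  exact ⟨k, hk, nonempty_linearEquiv _ _ (by simp [hk])⟩

theorem hasColouring_affPerm (p : ℕ) [Fact p.Prime] (V : Type*) [AddCommGroup V]
    [Module (ZMod p) V] [Fintype V] [Nontrivial V] :
    HasColouring (affPerm V : Set (Perm V)) := by
  obtain ⟨k, -, ⟨e⟩⟩ := exists_linearEquiv_fin p V
  by_cases hp : p = 2
  · subst hp
    exact (hasColouring_fin_two k).transport e
  · exact (hasColouring_fin_odd hp k).transport e

theorem hasTwoSizes_affPerm (p : ℕ) [Fact p.Prime] (V : Type*) [AddCommGroup V]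
    [Module (ZMod p) V] [Finite V] [Nontrivial V]
    (h : p = 2 → Module.finrank (ZMod p) V ≠ 3) : HasTwoSizes V := by
  obtain ⟨k, hk, ⟨e⟩⟩ := exists_linearEquiv_fin p V
  by_cases hp : p = 2
  · subst hp
    exact (hasTwoSizes_fin_two k fun h2 => h rfl (by rw [hk, h2])).transport e
  · exact (hasTwoSizes_fin_odd hp k).transport e

end Dimension

/-! ### Irreducible solvable linear groups of dimension three over the field of two elements -/

section Octet

theorem exists_normal_abelian (H : Type*) [Group H] [Group.IsSolvable H] [Nontrivial H] :
    ∃ A : Subgroup H, A.Normal ∧ A ≠ ⊥ ∧ ∀ a ∈ A, ∀ b ∈ A, a * b = b * a := by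
  classical
  obtain ⟨n, hn⟩ := (Group.isSolvable_def H).1 inferInstance
  have h : ∃ n, derivedSeries H n = ⊥ := ⟨n, hn⟩
  obtain ⟨k, hk⟩ : ∃ k, Nat.find h = k + 1 := Nat.exists_eq_succ_of_ne_zero fun h0 => by
    have := Nat.find_spec h
    rw [h0, derivedSeries_zero] at this
    exact top_ne_bot this
  refine ⟨derivedSeries H k, derivedSeries_normal H k, Nat.find_min h (by omega), fun a ha b hb => ?_⟩
  have := Nat.find_spec h
  rw [hk, derivedSeries_succ] at this
  have hab := Subgroup.commutator_mem_commutator ha hb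
  rw [this, Subgroup.mem_bot, commutatorElement_eq_one_iff_mul_comm] at hab
  exact hab

theorem exists_abelian_le {M : Type*} [Group M] (H : Subgroup M) [Group.IsSolvable H] (hH : H ≠ ⊥) :
    ∃ A ≤ H, A ≠ ⊥ ∧ (∀ a ∈ A, ∀ b ∈ A, a * b = b * a) ∧ ∀ h ∈ H, ∀ a ∈ A, h * a * h⁻¹ ∈ A := by
  have := (Subgroup.nontrivial_iff_ne_bot H).2 hH
  obtain ⟨A, hn, hne, hc⟩ := exists_normal_abelian H
  refine ⟨A.map H.subtype, Subgroup.map_subtype_le A, ?_, ?_, ?_⟩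
  · rwa [Ne, Subgroup.map_eq_bot_iff_of_injective _ H.subtype_injective]
  · rintro _ ⟨a, ha, rfl⟩ _ ⟨b, hb, rfl⟩
    rw [← map_mul, hc a ha b hb, map_mul]
  · rintro h hh _ ⟨a, ha, rfl⟩
    exact ⟨⟨h, hh⟩ * a * ⟨h, hh⟩⁻¹, hn.conj_mem a ha _, rfl⟩

variable {V : Type*} [AddCommGroup V]

/-- An additive permutation as an endomorphism. -/
def additiveHom (a : Perm V) (ha : ∀ x y, a (x + y) = a x + a y) : V →+ V := AddMonoidHom.mk' a ha

variable {H A : Subgroup (Perm V)}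

theorem eq_bot_of_common_fixed (hadd : ∀ h ∈ H, ∀ x y, h (x + y) = h x + h y)
    (hirr : ∀ W : AddSubgroup V, (∀ h ∈ H, ∀ w ∈ W, h w ∈ W) → W = ⊥ ∨ W = ⊤)
    (hAH : A ≤ H) (hnorm : ∀ h ∈ H, ∀ a ∈ A, h * a * h⁻¹ ∈ A) {v : V} (hv : v ≠ 0)
    (hfix : ∀ a ∈ A, a v = v) : A = ⊥ := by
  let W : AddSubgroup V :=
    { carrier := {w | ∀ a ∈ A, a w = w}
      zero_mem' := fun a ha => map_zero (additiveHom a (hadd a (hAH ha)))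
      add_mem' := fun {x y} hx hy a ha => by rw [hadd a (hAH ha), hx a ha, hy a ha]
      neg_mem' := fun {x} hx a ha => by
        have := map_neg (additiveHom a (hadd a (hAH ha))) x
        exact this.trans (congrArg _ (hx a ha)) }
  have hW : W = ⊤ := by
    refine (hirr W fun h hh w hw a ha => ?_).resolve_left fun hbot => hv ?_
    · have := hw _ (hnorm h⁻¹ (H.inv_mem hh) a ha)
      rw [inv_inv, Perm.mul_apply, Perm.mul_apply] at this
      conv_rhs => rw [← this]
      exact (h.apply_symm_apply _).symm
    · have : v ∈ W := hfix
      rwa [hbot] at this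
  rw [Subgroup.eq_bot_iff_forall]
  intro a ha
  ext w
  have : w ∈ W := hW ▸ AddSubgroup.mem_top w
  exact this a ha

theorem fixed_of_invariant_card_two (hadd : ∀ a ∈ A, ∀ x y, a (x + y) = a x + a y)
    (K : AddSubgroup V) (hK : Nat.card K = 2) (hinv : ∀ a ∈ A, ∀ x ∈ K, a x ∈ K) :
    ∃ v : V, v ≠ 0 ∧ ∀ a ∈ A, a v = v := by
  have hK' : (K : Set V).ncard = 2 := hK
  obtain ⟨v, hv⟩ : ∃ v, (K : Set V) = {0, v} ∧ v ≠ 0 := by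
    obtain ⟨x, y, hxy, h⟩ := Set.ncard_eq_two.1 hK'
    have h0 : (0 : V) ∈ (K : Set V) := K.zero_mem
    rw [h] at h0 ⊢
    rcases h0 with rfl | rfl
    · exact ⟨y, rfl, hxy.symm⟩
    · exact ⟨x, Set.pair_comm _ _, hxy⟩
  refine ⟨v, hv.2, fun a ha => ?_⟩
  have h0 : a 0 = 0 := map_zero (additiveHom a (hadd a ha))
  have : a v ∈ (K : Set V) := hinv a ha v (by rw [← SetLike.mem_coe, hv.1]; simp)
  rw [hv.1] at this
  rcases this with h | h
  · exact absurd (a.injective (h.trans h0.symm)) hv.2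
  · exact h

theorem eq_one_of_fixed (hV : Nat.card V = 8) (hadd : ∀ h ∈ H, ∀ x y, h (x + y) = h x + h y)
    (hirr : ∀ W : AddSubgroup V, (∀ h ∈ H, ∀ w ∈ W, h w ∈ W) → W = ⊥ ∨ W = ⊤)
    (hAH : A ≤ H) (hcomm : ∀ a ∈ A, ∀ b ∈ A, a * b = b * a)
    (hnorm : ∀ h ∈ H, ∀ a ∈ A, h * a * h⁻¹ ∈ A) {a : Perm V} (ha : a ∈ A) {v : V} (hv : v ≠ 0)
    (hav : a v = v) : a = 1 := by
  by_contra hne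
  have hA : A ≠ ⊥ := fun h => hne (by rwa [h, Subgroup.mem_bot] at ha)
  have hadd' : ∀ a ∈ A, ∀ x y, a (x + y) = a x + a y := fun a ha => hadd a (hAH ha)
  have hno : ∀ K : AddSubgroup V, Nat.card K = 2 → ¬ ∀ a ∈ A, ∀ x ∈ K, a x ∈ K := by
    intro K hK hinv
    obtain ⟨w, hw, hfix⟩ := fixed_of_invariant_card_two hadd' K hK hinv
    exact hA (eq_bot_of_common_fixed hadd hirr hAH hnorm hw hfix)
  have : Finite V := Nat.finite_of_card_ne_zero (by rw [hV]; norm_num)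
  let φ : V →+ V := additiveHom a (hadd' a ha) - AddMonoidHom.id V
  have hφ : ∀ x, φ x = a x - x := fun _ => rfl
  have hcard : Nat.card φ.ker * Nat.card φ.range = 8 := by
    rw [← hV, ← φ.ker.card_mul_index, AddSubgroup.index_ker]
  have hker : Nat.card φ.ker ≠ 1 := fun h => by
    rw [AddSubgroup.card_eq_one] at h
    have : v ∈ φ.ker := by rw [AddMonoidHom.mem_ker, hφ, hav, sub_self]
    rw [h] at this
    exact hv this
  have hran : Nat.card φ.range ≠ 1 := fun h => by
    rw [AddSubgroup.card_eq_one] at h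
    refine hne (Equiv.ext fun x => ?_)
    have : φ x ∈ φ.range := ⟨x, rfl⟩
    rw [h, AddSubgroup.mem_bot, hφ, sub_eq_zero] at this
    exact this
  have hb : ∀ b ∈ A, ∀ x, φ (b x) = b (φ x) := fun b hb x => by
    have h1 : a (b x) = b (a x) := by rw [← Perm.mul_apply, hcomm a ha b hb, Perm.mul_apply]
    rw [hφ, hφ, h1]
    exact (map_sub (additiveHom b (hadd' b hb)) _ _).symm
  have h28 : Nat.card φ.ker = 2 ∨ Nat.card φ.range = 2 := by
    have hdvd : Nat.card φ.ker ∣ 2 ^ 3 := ⟨_, hcard.symm⟩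
    obtain ⟨i, hi, h⟩ := (Nat.dvd_prime_pow Nat.prime_two).1 hdvd
    rw [h] at hcard hker ⊢
    interval_cases i <;> omega
  rcases h28 with h | h
  · refine hno _ h fun b hbA x hx => ?_
    rw [AddMonoidHom.mem_ker] at hx ⊢
    rw [hb b hbA, hx]
    exact map_zero (additiveHom b (hadd' b hbA))
  · refine hno _ h fun b hbA x hx => ?_
    obtain ⟨y, rfl⟩ := hx
    exact ⟨b y, hb b hbA y⟩

theorem transitive_of_order_seven [Finite V] (hV : Nat.card V = 8)
    (hfree : ∀ a ∈ A, ∀ v : V, v ≠ 0 → a v = v → a = 1) (h0 : ∀ a ∈ A, a 0 = 0)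
    {b : Perm V} (hbA : b ∈ A) (hb : orderOf b = 7) {v w : V} (hv : v ≠ 0) (hw : w ≠ 0) :
    ∃ n : ℕ, (b ^ n) v = w := by
  let s : Set V := (fun n : ℕ => (b ^ n) v) '' (Set.Iio 7)
  have hinj : Set.InjOn (fun n : ℕ => (b ^ n) v) (Set.Iio 7) := by
    intro i hi j hj hij
    wlog hle : i ≤ j generalizing i j
    · exact (this hj hi hij.symm (by omega)).symm
    have h1 : (b ^ (j - i)) v = v := by
      apply (b ^ i).injective
      rw [← Perm.mul_apply, ← pow_add, Nat.add_sub_cancel' hle]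
      exact hij.symm
    have := orderOf_dvd_of_pow_eq_one (hfree _ (A.pow_mem hbA _) v hv h1)
    rw [hb] at this
    have := Nat.eq_zero_of_dvd_of_lt this (by simp only [Set.mem_Iio] at hj; omega)
    omega
  have hs : s.ncard = 7 := by
    rw [hinj.ncard_image, Set.ncard_eq_toFinset_card']; simp
  have hsub : s ⊆ {0}ᶜ := by
    rintro _ ⟨n, -, rfl⟩ h
    exact hv ((b ^ n).injective (h.trans (h0 _ (A.pow_mem hbA n)).symm))
  have : s = {0}ᶜ := Set.eq_of_subset_of_ncard_le hsub (by
    rw [Set.ncard_compl, Set.ncard_singleton, hV, hs])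
  have hw' : w ∈ s := this ▸ hw
  obtain ⟨n, -, h⟩ := hw'
  exact ⟨n, h⟩

theorem exists_order_seven [Finite V] (hV : Nat.card V = 8) (hA : A ≠ ⊥)
    (hfree : ∀ a ∈ A, ∀ v : V, v ≠ 0 → a v = v → a = 1) (h0 : ∀ a ∈ A, a 0 = 0) :
    ∃ a ∈ A, orderOf a = 7 := by
  classical
  have := Fintype.ofFinite V
  obtain ⟨a, ha, hne⟩ := A.bot_or_exists_ne_one.resolve_left hA
  obtain ⟨q, hq, hdvd⟩ := Nat.exists_prime_and_dvd (n := orderOf a) (by rwa [Ne, orderOf_eq_one_iff])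
  have : Fact q.Prime := ⟨hq⟩
  refine ⟨a ^ (orderOf a / q), A.pow_mem ha _, ?_⟩
  have ho := orderOf_pow_orderOf_div (orderOf_pos a).ne' hdvd
  have hb := A.pow_mem ha (orderOf a / q)
  generalize a ^ (orderOf a / q) = b at *
  rw [ho]
  have hb1 : b ≠ 1 := fun h => by
    rw [h, orderOf_one] at ho
    exact hq.one_lt.ne ho
  have key := Equiv.Perm.card_compl_support_modEq (σ := b) (p := q) (n := 1)
    (by rw [pow_one, ← ho, pow_orderOf_eq_one])
  have hfix : b.supportᶜ = {0} := by
    ext x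
    rw [Finset.mem_compl, Perm.notMem_support, Finset.mem_singleton]
    refine ⟨fun hx => by_contra fun hx0 => hb1 (hfree b hb x hx0 hx), ?_⟩
    rintro rfl
    exact h0 b hb
  rw [hfix, Finset.card_singleton, ← Nat.card_eq_fintype_card, hV] at key
  have h7 : q ∣ 7 := (Nat.modEq_iff_dvd' (by norm_num)).1 key
  exact (Nat.prime_dvd_prime_iff_eq hq (by norm_num)).1 h7

/-- In an irreducible solvable linear group of dimension three over the field of two elements, only
the identity fixes two nonzero vectors. -/
theorem eq_one_of_two_fixed [Finite V] [Group.IsSolvable H] (hV : Nat.card V = 8)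
    (hadd : ∀ h ∈ H, ∀ x y, h (x + y) = h x + h y)
    (hirr : ∀ W : AddSubgroup V, (∀ h ∈ H, ∀ w ∈ W, h w ∈ W) → W = ⊥ ∨ W = ⊤)
    {h : Perm V} (hh : h ∈ H) {v w : V} (hv : v ≠ 0) (hw : w ≠ 0) (hvw : v ≠ w)
    (hhv : h v = v) (hhw : h w = w) : h = 1 := by
  by_cases hH : H = ⊥
  · rwa [hH, Subgroup.mem_bot] at hh
  obtain ⟨A, hAH, hA, hcomm, hnorm⟩ := exists_abelian_le H hH
  have hfree : ∀ a ∈ A, ∀ v : V, v ≠ 0 → a v = v → a = 1 := fun a ha v hv =>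
    eq_one_of_fixed hV hadd hirr hAH hcomm hnorm ha hv
  have h0 : ∀ h ∈ H, h 0 = 0 := fun h hh => map_zero (additiveHom h (hadd h hh))
  have h0A : ∀ a ∈ A, a 0 = 0 := fun a ha => h0 a (hAH ha)
  obtain ⟨a, ha, hord⟩ := exists_order_seven hV hA hfree h0A
  obtain ⟨i, hi⟩ := transitive_of_order_seven hV hfree h0A ha hord hv hw
  have hb := A.pow_mem ha i
  have hb1 : a ^ i ≠ 1 := fun h1 => hvw (by rw [← hi, h1, Perm.one_apply])
  have hb7 : (a ^ i) ^ 7 = 1 := by rw [← pow_mul, mul_comm, pow_mul, ← hord, pow_orderOf_eq_one, one_pow]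
  generalize a ^ i = b at *
  have : Fact (Nat.Prime 7) := ⟨by norm_num⟩
  have hordb : orderOf b = 7 := orderOf_eq_prime hb7 hb1
  have hinv : h⁻¹ v = v := Perm.inv_eq_iff_eq.2 hhv.symm
  have hc : b⁻¹ * (h * b * h⁻¹) = 1 := by
    refine hfree _ (A.mul_mem (A.inv_mem hb) (hnorm h hh b hb)) v hv ?_
    rw [Perm.mul_apply, Perm.mul_apply, Perm.mul_apply, hinv, hi, hhw, ← hi]
    exact b.symm_apply_apply v
  have hc' : Commute h b := by
    rw [inv_mul_eq_one] at hc
    exact (eq_mul_inv_iff_mul_eq.1 hc).symm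
  ext x
  rw [Perm.one_apply]
  by_cases hx : x = 0
  · rw [hx, h0 h hh]
  obtain ⟨n, rfl⟩ := transitive_of_order_seven hV hfree h0A hb hordb hv hx
  rw [← Perm.mul_apply, (hc'.pow_right n).eq, Perm.mul_apply, hhv]

set_option synthInstance.maxSize 1000 in
theorem perm_fin_four :
    (∀ a b : Perm (Fin 4), a ^ 3 = 1 → b ^ 3 = 1 → a * b = b * a ∨
      ((a * b) ^ 2 = 1 ∧ ∀ x, (a * b) x ≠ x) ∨ ((a * b ^ 2) ^ 2 = 1 ∧ ∀ x, (a * b ^ 2) x ≠ x)) ∧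
    ∀ a : Perm (Fin 4), a ^ 6 = 1 ∨ ((a ^ 2) ^ 2 = 1 ∧ ∀ x, (a ^ 2) x ≠ x) := by
  decide +kernel

/-- The stabilizer of a set of four points on which it acts faithfully and without double
transpositions. -/
theorem threeByTwo_of_ncard_four {α : Type*} (P : Subgroup (Perm α)) {D : Set α}
    (h4 : D.ncard = 4) (hfaith : ∀ f ∈ P, ∀ g ∈ P, (∀ x ∈ D, f x = g x) → f = g)
    (hno : ∀ f ∈ permStab P D, (∀ x ∈ D, f (f x) = x) → ∃ x ∈ D, f x = x) :
    ThreeByTwo (permStab P D) := by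
  have hD : D.Finite := Set.finite_of_ncard_ne_zero (by omega)
  have := hD.fintype
  have e : D ≃ Fin 4 := by
    rw [← h4, Set.ncard_eq_toFinset_card', Set.toFinset_card]; exact Fintype.equivFin D
  let S : Subgroup (Perm α) :=
    { carrier := permStab P D
      one_mem' := ⟨P.one_mem, fun _ => Iff.rfl⟩
      mul_mem' := fun {f g} hf hg => ⟨P.mul_mem hf.1 hg.1, fun x => (hf.2 _).trans (hg.2 x)⟩
      inv_mem' := fun {f} hf => ⟨P.inv_mem hf.1, fun x => by
        rw [← hf.2 (f⁻¹ x)]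
        exact iff_of_eq (congrArg (· ∈ D) (f.apply_symm_apply x))⟩ }
  let ρ : S →* Perm (Fin 4) :=
    { toFun := fun f => e.permCongrHom (f.1.subtypePerm f.2.2)
      map_one' := by rw [← map_one e.permCongrHom]; congr 1
      map_mul' := fun f g => by rw [← map_mul]; congr 1 }
  have hρ : ∀ (f : S) (x : D), (ρ f (e x)) = e ⟨f.1 x, (f.2.2 x).2 x.2⟩ := fun f x => by
    simp [ρ]
  have hinj : Function.Injective ρ := by
    intro f g hfg
    refine Subtype.ext (hfaith _ f.2.1 _ g.2.1 fun x hx => ?_)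
    have := congrArg (fun k : Perm (Fin 4) => k (e ⟨x, hx⟩)) hfg
    simp only [hρ, EmbeddingLike.apply_eq_iff_eq, Subtype.mk.injEq] at this
    exact this
  have hdt : ∀ f : S, (ρ f) ^ 2 = 1 → ¬ ∀ x, ρ f x ≠ x := by
    intro f h2 hx
    rw [← map_pow, ← map_one ρ] at h2
    have h2 := congrArg Subtype.val (hinj h2)
    obtain ⟨x, hxD, h⟩ := hno f.1 f.2 fun x _ => Equiv.congr_fun h2 x
    refine hx (e ⟨x, hxD⟩) ?_
    rw [hρ]
    simp only [h]
  refine ⟨fun f hf g hg hf3 hg3 => ?_, fun f hf => ⟨1, ?_⟩⟩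
  · have h3 : ∀ k : S, k.1 ^ 3 = 1 → ρ k ^ 3 = 1 := fun k hk => by
      rw [← map_pow, ← map_one ρ]; exact congrArg ρ (Subtype.ext hk)
    rcases perm_fin_four.1 (ρ ⟨f, hf⟩) (ρ ⟨g, hg⟩) (h3 _ hf3) (h3 _ hg3) with h | h | h
    · rw [← map_mul, ← map_mul] at h
      exact congrArg Subtype.val (hinj h)
    · rw [← map_mul] at h
      exact absurd h.2 (hdt _ h.1)
    · rw [← map_pow, ← map_mul] at h
      exact absurd h.2 (hdt _ h.1)
  · rcases perm_fin_four.2 (ρ ⟨f, hf⟩) with h | h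
    · rw [← map_pow, ← map_one ρ] at h
      exact congrArg Subtype.val (hinj h)
    · rw [← map_pow] at h
      exact absurd h.2 (hdt _ h.1)

theorem exists_threeByTwo_octet [Finite V] (P : Subgroup (Perm V)) (hP : P ≤ affPerm V)
    [Group.IsSolvable P] (htrans : ∀ v, Equiv.addRight v ∈ P) (hV : Nat.card V = 8)
    (htwo : ∀ x : V, x + x = 0)
    (hirr : ∀ W : AddSubgroup V, (∀ h ∈ P, h 0 = 0 → ∀ w ∈ W, h w ∈ W) → W = ⊥ ∨ W = ⊤) :
    ∃ D E : Set V, D.ncard = 3 ∧ E.ncard = 4 ∧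
      ThreeByTwo (permStab (P : Set (Perm V)) D) ∧ ThreeByTwo (permStab (P : Set (Perm V)) E) := by
  have hneg : ∀ x : V, -x = x := fun x => neg_eq_of_add_eq_zero_left (htwo x)
  have hsub : ∀ x y : V, x - y = x + y := fun x y => by rw [sub_eq_add_neg, hneg]
  let H : Subgroup (Perm V) :=
    { carrier := {h | h ∈ P ∧ h 0 = 0}
      one_mem' := ⟨P.one_mem, rfl⟩
      mul_mem' := fun {f g} hf hg => ⟨P.mul_mem hf.1 hg.1, by
        rw [Perm.mul_apply, hg.2, hf.2]⟩
      inv_mem' := fun {f} hf => ⟨P.inv_mem hf.1, Perm.inv_eq_iff_eq.2 hf.2.symm⟩ }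
  have hHP : H ≤ P := fun h hh => hh.1
  have : Group.IsSolvable H := 
    Group.isSolvable_of_isSolvable_injective (Subgroup.inclusion_injective hHP)
  have key : ∀ h ∈ P, h 0 = 0 → ∀ v w : V, v ≠ 0 → w ≠ 0 → v ≠ w → h v = v → h w = w → h = 1 :=
    fun h hh hz v w hv hw hvw hhv hhw =>
      eq_one_of_two_fixed (H := H) hV (fun k hk x y => by
        rw [affPerm_add (hP hk.1), hk.2, sub_zero])
        (fun W hW => hirr W fun k hk hk0 => hW k ⟨hk, hk0⟩) ⟨hh, hz⟩ hv hw hvw hhv hhw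
  have key2 : ∀ f ∈ P, ∀ x y z t : V, x ≠ y → z ≠ t → x + y ≠ z + t → f x + f y = x + y →
      f z + f t = z + t → ∃ c, ∀ x, f x = x + c := by
    intro f hf x y z t hxy hzt hne h1 h2
    have hl : ∀ x y, (f (x + y)) + f 0 = f x + f y := fun x y => by
      rw [affPerm_add (hP hf), sub_add_cancel]
    have hne' : ∀ x y : V, x ≠ y → x + y ≠ 0 := fun x y hxy h => by
      rw [← hsub, sub_eq_zero] at h; exact hxy h
    have := key (Equiv.addRight (f 0) * f) (P.mul_mem (htrans _) hf) (htwo _) (x + y) (z + t)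
      (hne' _ _ hxy) (hne' _ _ hzt) hne ((hl x y).trans h1) ((hl z t).trans h2)
    refine ⟨f 0, fun w => ?_⟩
    have hw : f w + f 0 = w := Equiv.congr_fun this w
    rw [← hw, add_assoc, htwo, add_zero]
    rw [hw]
  have faith : ∀ D : Set V, 3 ≤ D.ncard → ∀ f ∈ P, ∀ g ∈ P, (∀ x ∈ D, f x = g x) → f = g := by
    intro D hD f hf g hg h
    obtain ⟨x, hx, y, hy, z, hz, hxy, hxz, hyz⟩ := (Set.two_lt_ncard (Set.toFinite D)).1 hD
    have hfix : ∀ x ∈ D, (g⁻¹ * f) x = x := fun x hx => by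
      rw [Perm.mul_apply, h x hx]; exact g.symm_apply_apply x
    obtain ⟨c, hc⟩ := key2 (g⁻¹ * f) (P.mul_mem (P.inv_mem hg) hf) x y x z hxy hxz
      (fun h => hyz (add_left_cancel h)) (by rw [hfix x hx, hfix y hy]) (by rw [hfix x hx, hfix z hz])
    have hc0 : c = 0 := by
      have := hc x
      rw [hfix x hx] at this
      exact left_eq_add.1 this
    ext w
    have := hc w
    rw [hc0, add_zero] at this
    exact (Perm.inv_eq_iff_eq.1 this)
  obtain ⟨D, -, hD⟩ := Set.exists_subset_card_eq (s := (Set.univ : Set V)) (n := 3) (by rw [Set.ncard_univ, hV]; norm_num)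
  obtain ⟨x, y, z, hxy, hxz, hyz, rfl⟩ := Set.ncard_eq_three.1 hD
  obtain ⟨t, ht⟩ : ∃ t, t ∉ ({x, y, z, x + y + z} : Set V) := by
    by_contra! hall
    have h1 : (Set.univ : Set V).ncard ≤ ({x, y, z, x + y + z} : Set V).ncard :=
      Set.ncard_le_ncard fun t _ => hall t
    have h2 := Set.ncard_insert_le x ({y, z, x + y + z} : Set V)
    have h3 := Set.ncard_insert_le y ({z, x + y + z} : Set V)
    have h4 := Set.ncard_insert_le z ({x + y + z} : Set V)
    rw [Set.ncard_singleton] at h4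
    rw [Set.ncard_univ, hV] at h1
    omega
  simp only [Set.mem_insert_iff, Set.mem_singleton_iff, not_or] at ht
  have hE : (insert t {x, y, z} : Set V).ncard = 4 := by
    rw [Set.ncard_insert_of_notMem, hD]
    simp [ht.1, ht.2.1, ht.2.2.1]
  refine ⟨{x, y, z}, _, hD, hE, threeByTwo_of_ncard_le_three P (Set.toFinite _) hD.le
    (faith _ hD.ge), threeByTwo_of_ncard_four P hE (faith _ (by omega)) fun f hf h2 => ?_⟩
  have hswap : ∀ x y z t : V, x ≠ y → z ≠ t → t ≠ x + y + z → f x = y → f y = x → f z = t → f t = z →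
      False := by
    intro x y z t hxy hzt hne h1 h2 h3 h4
    obtain ⟨c, hc⟩ := key2 f hf.1 x y z t hxy hzt
      (fun h => hne (by rw [h, add_right_comm, htwo, zero_add]))
      (by rw [h1, h2, add_comm]) (by rw [h3, h4, add_comm])
    refine hne ?_
    rw [← h3, hc, ← h1, hc, ← add_assoc, htwo, zero_add, add_comm]
  by_contra! hno
  have hx := (hf.2 x).2 (by simp)
  have hy := (hf.2 y).2 (by simp)
  have hz := (hf.2 z).2 (by simp)
  have htt := (hf.2 t).2 (by simp)
  simp only [Set.mem_insert_iff, Set.mem_singleton_iff, forall_eq_or_imp, forall_eq]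
    at hx hy hz htt hno h2
  obtain ⟨htx, hty, htz, hts⟩ := ht
  rcases htt with h | h | h | h
  · exact hno.1 h
  · refine hswap y z x t hyz (Ne.symm htx) (by rwa [add_comm, ← add_assoc]) ?_ ?_ ?_ h <;> grind
  · refine hswap x z y t hxz (Ne.symm hty) (by rwa [add_right_comm]) ?_ ?_ ?_ h <;> grind
  · refine hswap x y z t hxy (Ne.symm htz) hts ?_ ?_ ?_ h <;> grind

end Octet

/-! ### Primitive solvable groups -/

section Primitive

open MulAction

theorem exists_regular_normal {M B : Type*} [Group M] [MulAction M B] [FaithfulSMul M B]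
    [IsPreprimitive M B] [Group.IsSolvable M] [Finite B] [Nontrivial B] :
    ∃ p : ℕ, p.Prime ∧ ∃ N : Subgroup M, N.Normal ∧ (∀ a ∈ N, ∀ b ∈ N, a * b = b * a) ∧
      (∀ a ∈ N, a ^ p = 1) ∧ (∀ x y : B, ∃ a ∈ N, a • x = y) ∧
      ∀ a ∈ N, ∀ x : B, a • x = x → a = 1 := by
  have : Finite M := Finite.of_injective (toPerm : M → Perm B) toPerm_injective
  obtain ⟨x, y, hxy⟩ := exists_pair_ne B
  obtain ⟨g, hg⟩ := exists_smul_eq M x y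
  have : Nontrivial M := ⟨g, 1, fun h => hxy (by rw [← hg, h, one_smul])⟩
  obtain ⟨A, hAn, hA, hc⟩ := exists_normal_abelian M
  obtain ⟨p, hp, hdvd⟩ := Nat.exists_prime_and_dvd
    (n := Nat.card A) fun h => hA (Subgroup.card_eq_one.1 h)
  have : Fact p.Prime := ⟨hp⟩
  obtain ⟨b, hb⟩ := exists_prime_orderOf_dvd_card' p hdvd
  let N : Subgroup M :=
    { carrier := {a | a ∈ A ∧ a ^ p = 1}
      one_mem' := ⟨A.one_mem, one_pow p⟩
      mul_mem' := fun {a b} ha hb => ⟨A.mul_mem ha.1 hb.1, by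
        rw [Commute.mul_pow (hc a ha.1 b hb.1), ha.2, hb.2, one_mul]⟩
      inv_mem' := fun {a} ha => ⟨A.inv_mem ha.1, by rw [inv_pow, ha.2, inv_one]⟩ }
  have hN : N.Normal := ⟨fun a ha g => ⟨hAn.conj_mem a ha.1 g, by
    rw [conj_pow, ha.2, mul_one, mul_inv_cancel]⟩⟩
  have hbN : (b : M) ∈ N := ⟨b.2, by rw [← Subgroup.coe_pow, ← hb, pow_orderOf_eq_one]; rfl⟩
  have hb1 : (b : M) ≠ 1 := fun h => by
    rw [← Subgroup.orderOf_coe, h, orderOf_one] at hb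
    exact hp.one_lt.ne hb
  have hcomm : ∀ a ∈ N, ∀ b ∈ N, a * b = b * a := fun a ha b hb => hc a ha.1 b hb.1
  have htrans : IsPretransitive N B := IsQuasiPreprimitive.isPretransitive_of_normal fun h => by
    refine hb1 (FaithfulSMul.eq_of_smul_eq_smul (α := B) fun x => ?_)
    have hx : x ∈ fixedPoints N B := h ▸ Set.mem_univ x
    rw [one_smul]
    exact hx ⟨b, hbN⟩
  have ht : ∀ x y : B, ∃ a ∈ N, a • x = y := fun x y => by
    obtain ⟨a, h⟩ := exists_smul_eq N x y
    exact ⟨a, a.2, h⟩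
  refine ⟨p, hp, N, hN, hcomm, fun a ha => ha.2, ht, fun a ha x hx => ?_⟩
  refine FaithfulSMul.eq_of_smul_eq_smul (α := B) fun y => ?_
  obtain ⟨c, hcN, rfl⟩ := ht x y
  rw [smul_smul, hcomm a ha c hcN, ← smul_smul, hx, one_smul]

universe u

/-- A primitive solvable group acts on an affine space by affine permutations and contains the
translations. -/
theorem exists_affine {B : Type u} [Finite B] [Nontrivial B] (P : Subgroup (Perm B))
    [IsPreprimitive P B] [Group.IsSolvable P] :
    ∃ (p : ℕ) (_ : Fact p.Prime) (V : Type u) (_ : AddCommGroup V) (_ : Module (ZMod p) V)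
      (e : B ≃ V), (∀ f ∈ P, e.permCongrHom f ∈ affPerm V) ∧
        ∀ v, e.symm.permCongrHom (Equiv.addRight v) ∈ P := by
  obtain ⟨p, hp, N, hN, hc, hexp, ht, hfree⟩ := exists_regular_normal (M := P) (B := B)
  let _ : CommGroup N :=
    { (inferInstance : Group N) with
      mul_comm := fun a b => Subtype.ext (hc a a.2 b b.2) }
  let _ : Module (ZMod p) (Additive N) := AddCommGroup.zmodModule fun x =>
    Additive.toMul.injective (Subtype.ext (hexp _ (Additive.toMul x).2))
  obtain ⟨x₀⟩ := (inferInstance : Nonempty B)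
  have hbij : Function.Bijective fun v : Additive N => v.toMul.1 • x₀ := by
    refine ⟨fun v w h => ?_, fun y => ?_⟩
    · refine Additive.toMul.injective (Subtype.ext ?_)
      refine inv_mul_eq_one.1 (hfree _ (N.mul_mem (N.inv_mem v.toMul.2) w.toMul.2) x₀ ?_)
      rw [mul_smul, inv_smul_eq_iff]
      exact h.symm
    · obtain ⟨a, ha, h⟩ := ht x₀ y
      exact ⟨Additive.ofMul ⟨a, ha⟩, h⟩
  let e' : Additive N ≃ B := Equiv.ofBijective _ hbij
  have he' : ∀ v, e' v = v.toMul.1 • x₀ := fun _ => rfl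
  refine ⟨p, ⟨hp⟩, Additive N, inferInstance, inferInstance, e'.symm, fun f hf => ?_, fun v => ?_⟩
  · obtain ⟨k, hk, hfk⟩ := ht x₀ (f x₀)
    let F : P := ⟨f, hf⟩
    have hF : ∀ v, e'.symm.permCongrHom f v = Additive.ofMul
        ((⟨F * v.toMul * F⁻¹, hN.conj_mem _ v.toMul.2 F⟩ : N) * ⟨k, hk⟩) := fun v => by
      apply e'.injective
      rw [Equiv.permCongrHom_coe, Equiv.permCongr_apply, Equiv.apply_symm_apply,
        Equiv.symm_symm, he', he', toMul_ofMul, Subgroup.coe_mul, mul_smul, hfk]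
      change _ = (F * v.toMul * F⁻¹) • F • x₀
      rw [smul_smul, inv_mul_cancel_right, mul_smul]
      rfl
    intro x y z
    simp only [hF]
    apply Additive.toMul.injective
    apply Subtype.ext
    simp only [toMul_add, toMul_sub, toMul_ofMul, Subgroup.coe_mul, Subgroup.coe_div]
    have hx := hN.conj_mem _ x.toMul.2 F
    have hy := hN.conj_mem _ y.toMul.2 F
    have hz := hN.conj_mem _ z.toMul.2 F
    rw [div_eq_mul_inv, div_eq_mul_inv, mul_inv_rev]
    have h1 : F * (↑x.toMul * (↑y.toMul)⁻¹ * ↑z.toMul) * F⁻¹ =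
        (F * x.toMul * F⁻¹) * (F * y.toMul * F⁻¹)⁻¹ * (F * z.toMul * F⁻¹) := by group
    rw [h1]
    group
  · have : e'.symm.symm.permCongrHom (Equiv.addRight v) = (v.toMul : P).1 := by
      ext b
      obtain ⟨w, rfl⟩ := e'.surjective b
      rw [Equiv.permCongrHom_coe, Equiv.permCongr_apply, Equiv.symm_symm,
        Equiv.symm_apply_apply, Equiv.coe_addRight, he']
      change _ = (v.toMul : P) • e' w
      rw [he']
      rw [smul_smul, toMul_add, ← Subgroup.coe_mul, mul_comm]
    rw [this]
    exact (v.toMul : P).2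

section Conjugation

variable {B V : Type*} (e : B ≃ V)

theorem twoElements_conj {S : Set (Perm B)} {T : Set (Perm V)}
    (h : ∀ f ∈ S, e.permCongrHom f ∈ T) (hT : TwoElements T) : TwoElements S := by
  intro f hf
  obtain ⟨m, hm⟩ := hT _ (h f hf)
  exact ⟨m, e.permCongrHom.injective (by rw [map_pow, hm, map_one])⟩

theorem threeByTwo_conj {S : Set (Perm B)} {T : Set (Perm V)}
    (h : ∀ f ∈ S, e.permCongrHom f ∈ T) (hT : ThreeByTwo T) : ThreeByTwo S := by
  refine ⟨fun f hf g hg hf3 hg3 => e.permCongrHom.injective ?_, fun f hf => ?_⟩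
  · rw [map_mul, map_mul]
    exact hT.1 _ (h f hf) _ (h g hg) (by rw [← map_pow, hf3, map_one])
      (by rw [← map_pow, hg3, map_one])
  · obtain ⟨m, hm⟩ := hT.2 _ (h f hf)
    exact ⟨m, e.permCongrHom.injective (by rw [map_pow, hm, map_one])⟩

theorem hasColouring_conj [Fintype B] [Fintype V] {S : Set (Perm B)} {T : Set (Perm V)}
    (h : ∀ f ∈ S, e.permCongrHom f ∈ T) (hT : HasColouring T) : HasColouring S := by
  obtain ⟨c, hc, h2⟩ := hT
  refine ⟨c ∘ e, ?_, twoElements_conj (T := colourStab T c) e (fun f hf => ⟨h f hf.1, fun x => ?_⟩) h2⟩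
  · rwa [colourSum, Fintype.sum_equiv e (fun x => ZMod.stdAddChar ((c ∘ e) x))
      (fun x => ZMod.stdAddChar (c x)) fun x => rfl]
  · have := hf.2 (e.symm x)
    simpa using this

theorem permCongr_mem_permStab_preimage {S : Set (Perm B)} {T : Set (Perm V)}
    (h : ∀ f ∈ S, e.permCongrHom f ∈ T) {D : Set V} {f : Perm B} (hf : f ∈ permStab S (e ⁻¹' D)) :
    e.permCongrHom f ∈ permStab T D := by
  refine ⟨h f hf.1, fun x => ?_⟩
  have := hf.2 (e.symm x)
  simpa using this

theorem ncard_preimage (D : Set V) : (e ⁻¹' D).ncard = D.ncard :=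
  Set.ncard_preimage_of_injective_subset_range e.injective fun x _ => e.surjective x

end Conjugation

theorem hasColouring_of_isPreprimitive {B : Type*} [Fintype B] [Nontrivial B]
    (P : Subgroup (Perm B)) [IsPreprimitive P B] [Group.IsSolvable P] :
    HasColouring (P : Set (Perm B)) := by
  obtain ⟨p, _, V, _, _, e, hP, -⟩ := exists_affine P
  have := Fintype.ofEquiv B e
  have := e.symm.nontrivial
  exact hasColouring_conj e hP (hasColouring_affPerm p V)

theorem invariant_eq_bot_or_top {B V : Type*} [AddCommGroup V] [Finite V] (P : Subgroup (Perm B))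
    [IsPreprimitive P B] (e : B ≃ V) (hP : ∀ f ∈ P, e.permCongrHom f ∈ affPerm V)
    (htrans : ∀ v, e.symm.permCongrHom (Equiv.addRight v) ∈ P) (W : AddSubgroup V)
    (hW : ∀ h ∈ P.map e.permCongrHom.toMonoidHom, h 0 = 0 → ∀ w ∈ W, h w ∈ W) :
    W = ⊥ ∨ W = ⊤ := by
  have hadd : ∀ v, Equiv.addRight v ∈ P.map e.permCongrHom.toMonoidHom := fun v =>
    ⟨_, htrans v, by ext; simp⟩
  have hblock : IsBlock P (e ⁻¹' (W : Set V)) := by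
    rw [isBlock_iff_smul_eq_of_nonempty]
    rintro f ⟨_, ⟨x, hx, rfl⟩, hy⟩
    have key : ∀ w ∈ W, e (f.1 (e.symm w)) ∈ W := by
      set F := e.permCongrHom f.1 with hF
      have hFP : F ∈ P.map e.permCongrHom.toMonoidHom := ⟨f.1, f.2, rfl⟩
      have hFa : F ∈ affPerm V := hP f.1 f.2
      have hl : ∀ w ∈ W, F w - F 0 ∈ W := fun w hw => by
        have := hW (Equiv.addRight (-F 0) * F) (Subgroup.mul_mem _ (hadd _) hFP)
          (by simp) w hw
        simpa [sub_eq_add_neg] using this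
      have h0 : F 0 ∈ W := by
        have h1 := hl _ hx
        have h2 : F (e x) ∈ W := by
          rw [hF, Equiv.permCongrHom_coe, Equiv.permCongr_apply, e.symm_apply_apply]
          exact hy
        simpa using W.sub_mem h2 h1
      intro w hw
      have : F w ∈ W := by simpa using W.add_mem (hl w hw) h0
      exact this
    have : Finite B := Finite.of_equiv V e.symm
    refine Set.eq_of_subset_of_ncard_le ?_ (by rw [Set.ncard_smul_set]) (Set.toFinite _)
    rintro _ ⟨z, hz, rfl⟩
    have := key _ hz
    rwa [e.symm_apply_apply] at this
  rcases IsPreprimitive.isTrivialBlock_of_isBlock hblock with h | h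
  · left
    rw [AddSubgroup.eq_bot_iff_forall]
    intro w hw
    have := h (show e.symm w ∈ e ⁻¹' (W : Set V) by simpa using hw)
      (show e.symm 0 ∈ e ⁻¹' (W : Set V) by simp)
    exact e.symm.injective this
  · right
    rw [AddSubgroup.eq_top_iff']
    intro w
    have : e.symm w ∈ e ⁻¹' (W : Set V) := h ▸ Set.mem_univ _
    simpa using this

theorem exists_threeByTwo_of_isPreprimitive {B : Type*} [Finite B] [Nontrivial B]
    (P : Subgroup (Perm B)) [IsPreprimitive P B] [Group.IsSolvable P] :
    ∃ D E : Set B, D.ncard < E.ncard ∧ 2 * E.ncard ≤ Nat.card B ∧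
      ThreeByTwo (permStab (P : Set (Perm B)) D) ∧
      ThreeByTwo (permStab (P : Set (Perm B)) E) := by
  obtain ⟨p, _, V, _, _, e, hP, htrans⟩ := exists_affine P
  have := Finite.of_equiv B e
  have := e.symm.nontrivial
  rw [Nat.card_congr e]
  by_cases h : p = 2 → Module.finrank (ZMod p) V ≠ 3
  · obtain ⟨_, _, hmn, hn, ⟨D, rfl, hD⟩, ⟨E, rfl, hE⟩⟩ := hasTwoSizes_affPerm p V h
    exact ⟨e ⁻¹' D, e ⁻¹' E, by rwa [ncard_preimage, ncard_preimage], by rwa [ncard_preimage],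
      threeByTwo_conj e (fun f hf => permCongr_mem_permStab_preimage e hP hf) hD,
      threeByTwo_conj e (fun f hf => permCongr_mem_permStab_preimage e hP hf) hE⟩
  · push Not at h
    obtain ⟨rfl, h3⟩ := h
    have hV : Nat.card V = 8 := by
      rw [Module.natCard_eq_pow_finrank (K := ZMod 2), h3, Nat.card_zmod]; norm_num
    let Q := P.map e.permCongrHom.toMonoidHom
    have hQ : ∀ f ∈ P, e.permCongrHom f ∈ Q := fun f hf => ⟨f, hf, rfl⟩
    have : Group.IsSolvable Q :=
      Group.isSolvable_of_surjective (e.permCongrHom.toMonoidHom.subgroupMap_surjective P)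
    obtain ⟨D, E, hD, hE, h1, h2⟩ := exists_threeByTwo_octet Q
      (by rintro _ ⟨f, hf, rfl⟩; exact hP f hf) (fun v => ⟨_, htrans v, by ext; simp⟩) hV
      (fun x => ZModModule.add_self x) (invariant_eq_bot_or_top P e hP htrans)
    exact ⟨e ⁻¹' D, e ⁻¹' E, by rw [ncard_preimage, ncard_preimage]; omega,
      by rw [ncard_preimage, hE, hV],
      threeByTwo_conj e (fun f hf => permCongr_mem_permStab_preimage e hQ hf) h1,
      threeByTwo_conj e (fun f hf => permCongr_mem_permStab_preimage e hQ hf) h2⟩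

end Primitive

/-! ### Imprimitive groups -/

section Imprimitive

open MulAction

/-- The action has a three-colouring with nonzero character sum that is preserved only by elements
inducing permutations of 2-power order. -/
def ActColouring (M Q : Type*) [Group M] [MulAction M Q] [Fintype Q] : Prop :=
  ∃ d : Q → ZMod 3, colourSum d ≠ 0 ∧
    ∀ g : M, (∀ q, d (g • q) = d q) → ∃ m : ℕ, ∀ q : Q, g ^ 2 ^ m • q = q

/-- The group induced on `X` by the setwise stabilizer of `D` has the required structure. -/
def ActThreeByTwo (M : Type*) {X : Type*} [Group M] [MulAction M X] (D : Set X) : Prop :=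
  (∀ f g : M, (∀ x, f • x ∈ D ↔ x ∈ D) → (∀ x, g • x ∈ D ↔ x ∈ D) →
    (∀ x : X, f ^ 3 • x = x) → (∀ x : X, g ^ 3 • x = x) → ∀ x : X, f • g • x = g • f • x) ∧
  ∀ f : M, (∀ x, f • x ∈ D ↔ x ∈ D) → ∃ m : ℕ, ∀ x : X, f ^ (3 * 2 ^ m) • x = x

theorem ActThreeByTwo.compl {M X : Type*} [Group M] [MulAction M X] {D : Set X}
    (h : ActThreeByTwo M D) : ActThreeByTwo M Dᶜ := by
  simpa only [ActThreeByTwo, Set.mem_compl_iff, not_iff_not] using h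

/-- `Ω` is identified with `Q × B` in such a way that `M` acts on `Ω` through the wreath product of
`P` by its action on `Q`. -/
def IsWreath {M Ω Q B : Type*} [Group M] [MulAction M Ω] [MulAction M Q] (P : Set (Perm B))
    (e : Ω ≃ Q × B) : Prop :=
  ∀ (g : M) (q : Q), ∃ h ∈ P, ∀ b, g • e.symm (q, b) = e.symm (g • q, h b)

theorem exists_isWreath {M Ω : Type*} [Group M] [Finite M] [Group.IsSolvable M] [MulAction M Ω]
    [IsPretransitive M Ω] [Nontrivial Ω] (a : Ω) :
    ∃ H : Subgroup M, stabilizer M a < H ∧ ∃ (B : Set Ω) (P : Subgroup (Perm B))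
      (e : Ω ≃ (M ⧸ H) × B), Nontrivial B ∧ IsPreprimitive P B ∧ Group.IsSolvable P ∧
        IsWreath (M := M) (P : Set (Perm B)) e := by
  have hS : ¬ IsMax (stabilizer M a) := by
    rw [isMax_iff_eq_top]
    intro h
    obtain ⟨b, hb⟩ := exists_ne a
    obtain ⟨g, rfl⟩ := exists_smul_eq M a b
    exact hb (show g ∈ stabilizer M a from h ▸ Subgroup.mem_top g)
  obtain ⟨H, hH⟩ := exists_covBy_of_wellFoundedLT hS
  let a' : orbit H a := ⟨a, mem_orbit_self a⟩
  have hnt : Nontrivial (orbit H a) := by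
    obtain ⟨h, hh, hhS⟩ := SetLike.exists_of_lt hH.lt
    exact ⟨⟨(⟨h, hh⟩ : H) • a', a', fun heq => hhS (congrArg Subtype.val heq)⟩⟩
  have hstab : stabilizer H a' = (stabilizer M a).subgroupOf H := by
    ext h
    rw [Subgroup.mem_subgroupOf, mem_stabilizer_iff, mem_stabilizer_iff, Subtype.ext_iff]
    rfl
  have hprim : IsPreprimitive H (orbit H a) := by
    rw [← isCoatom_stabilizer_iff_preprimitive H a', hstab]
    refine ⟨fun h => hH.lt.not_ge (Subgroup.subgroupOf_eq_top.1 h), fun K hK => ?_⟩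
    have h1 : stabilizer M a < K.map H.subtype := by
      have := (Subgroup.map_lt_map_iff_of_injective H.subtype_injective).2 hK
      rwa [Subgroup.subgroupOf_map_subtype, inf_eq_left.2 hH.le] at this
    have h2 : K.map H.subtype = H :=
      (hH.eq_or_eq h1.le (Subgroup.map_subtype_le K)).resolve_left h1.ne'
    rw [eq_top_iff]
    intro h _
    obtain ⟨k, hk, hkh⟩ : (h : M) ∈ K.map H.subtype := h2.symm ▸ h.2
    rwa [← Subtype.ext hkh]
  have hout : ∀ (g : M) (q : M ⧸ H), (g • q).out⁻¹ * (g * q.out) ∈ H := fun g q => by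
    rw [← QuotientGroup.eq, QuotientGroup.out_eq', ← smul_eq_mul, ← MulAction.Quotient.smul_mk,
      QuotientGroup.out_eq']
  have hbij : Function.Bijective fun x : (M ⧸ H) × orbit H a => x.1.out • x.2.1 := by
    refine ⟨?_, fun x => ?_⟩
    · rintro ⟨q, _, h, rfl⟩ ⟨q', _, h', rfl⟩ heq
      have hmem : (q.out * h)⁻¹ * (q'.out * h') ∈ stabilizer M a := by
        rw [mem_stabilizer_iff, mul_smul, inv_smul_eq_iff, mul_smul, mul_smul]
        exact heq.symm
      have hq : q = q' := by
        rw [← q.out_eq', ← q'.out_eq', QuotientGroup.eq]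
        have := H.mul_mem (H.mul_mem h.2 (hH.le hmem)) (H.inv_mem h'.2)
        convert this using 1
        group
      subst hq
      exact Prod.ext rfl (Subtype.ext (MulAction.injective _ heq))
    · obtain ⟨g, rfl⟩ := exists_smul_eq M a x
      refine ⟨((g : M ⧸ H), ⟨(⟨(g : M ⧸ H).out⁻¹ * g, ?_⟩ : H) • a, mem_orbit _ _⟩), ?_⟩
      · rw [← QuotientGroup.eq, QuotientGroup.out_eq']
      · change _ • (_ * g) • a = _
        rw [mul_smul, smul_inv_smul]
  refine ⟨H, hH.lt, orbit H a, (toPermHom H (orbit H a)).range, (Equiv.ofBijective _ hbij).symm,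
    hnt, ?_, Group.isSolvable_of_surjective (toPermHom H (orbit H a)).rangeRestrict_surjective, ?_⟩
  · let f : orbit H a →ₑ[(toPermHom H (orbit H a)).rangeRestrict] orbit H a :=
      { toFun := id
        map_smul' := fun _ _ => rfl }
    exact IsPreprimitive.of_surjective (f := f) Function.surjective_id
  · intro g q
    refine ⟨_, ⟨⟨_, hout g q⟩, rfl⟩, fun b => ?_⟩
    change g • q.out • b.1 = (g • q).out • (_ * (g * q.out)) • b.1
    rw [mul_smul, smul_inv_smul, mul_smul]

variable {M Ω Q B : Type*} [Group M] [MulAction M Ω]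

theorem isWreath_pow_smul {e : Ω ≃ Q × B} {g : M} {q : Q} {h : Perm B}
    (hh : ∀ b, g • e.symm (q, b) = e.symm (q, h b)) (n : ℕ) (b : B) :
    g ^ n • e.symm (q, b) = e.symm (q, (h ^ n) b) := by
  induction n generalizing b with
  | zero => simp
  | succ n ih => rw [pow_succ, mul_smul, hh, ih, pow_succ, Perm.mul_apply]

theorem pow_smul_eq_of_dvd {X : Type*} [MulAction M X] {g : M} {x : X} {m n : ℕ}
    (h : g ^ m • x = x) (hmn : m ∣ n) : g ^ n • x = x := by
  obtain ⟨k, rfl⟩ := hmn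
  rw [pow_mul]
  exact (stabilizer M x).pow_mem h k

/-- If every fibre is fixed by some power of `g`, then a common power fixes everything. -/
theorem exists_pow_of_fibres [Finite Q] {e : Ω ≃ Q × B} {g : M} {k : ℕ}
    (h : ∀ q, ∃ m : ℕ, ∀ b, g ^ (k * 2 ^ m) • e.symm (q, b) = e.symm (q, b)) :
    ∃ m : ℕ, ∀ x : Ω, g ^ (k * 2 ^ m) • x = x := by
  choose m hm using h
  obtain ⟨n, hn⟩ := Finite.exists_le m
  refine ⟨n, fun x => ?_⟩
  obtain ⟨⟨q, b⟩, rfl⟩ := e.symm.surjective x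
  exact pow_smul_eq_of_dvd (hm q b) (Nat.mul_dvd_mul_left _ (pow_dvd_pow 2 (hn q)))

variable [MulAction M Q] [Fintype Q]

theorem ActColouring.isWreath [Fintype B] [Fintype Ω] {P : Set (Perm B)} {e : Ω ≃ Q × B}
    (he : IsWreath (M := M) P e) (hQ : ActColouring M Q) (hP : HasColouring P) :
    ActColouring M Ω := by
  obtain ⟨d, hd, hd2⟩ := hQ
  obtain ⟨c, hc, hc2⟩ := hP
  refine ⟨fun x => d (e x).1 + c (e x).2, ?_, fun g hg => ?_⟩
  · have : colourSum (fun x => d (e x).1 + c (e x).2) = colourSum d * colourSum c := by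
      rw [colourSum, Fintype.sum_equiv e _ (fun y => ZMod.stdAddChar (d y.1 + c y.2)) fun _ => rfl,
        colourSum, colourSum, Fintype.sum_mul_sum, Fintype.sum_prod_type]
      simp only [AddChar.map_add_eq_mul]
    rw [this]
    exact mul_ne_zero hd hc
  · have hdg : ∀ q, d (g • q) = d q := fun q => by
      obtain ⟨h, -, hh⟩ := he g q
      have : ∀ b, d (g • q) + c (h b) = d q + c b := fun b => by
        have := hg (e.symm (q, b))
        simpa [hh] using this
      have hsum : ZMod.stdAddChar (d (g • q)) * colourSum c =
          ZMod.stdAddChar (d q) * colourSum c := by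
        have h1 : colourSum c = colourSum (c ∘ h) :=
          (Fintype.sum_equiv h _ _ fun _ => rfl).symm
        conv_lhs => rw [h1]
        rw [colourSum, colourSum, Finset.mul_sum, Finset.mul_sum]
        refine Finset.sum_congr rfl fun b _ => ?_
        rw [← AddChar.map_add_eq_mul, ← AddChar.map_add_eq_mul, ← this]
        rfl
      exact ZMod.injective_stdAddChar (mul_right_cancel₀ hc hsum)
    obtain ⟨m, hm⟩ := hd2 g hdg
    have key : ∀ q, ∃ n : ℕ, ∀ b,
        g ^ (2 ^ m * 2 ^ n) • e.symm (q, b) = e.symm (q, b) := fun q => by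
      obtain ⟨h, hhP, hh⟩ := he (g ^ 2 ^ m) q
      rw [hm] at hh
      have hgm : ∀ k : ℕ, ∀ x, d (e (g ^ k • x)).1 + c (e (g ^ k • x)).2 =
          d (e x).1 + c (e x).2 := fun k => by
        induction k with
        | zero => simp
        | succ k ih => intro x; rw [pow_succ', mul_smul]; exact (hg _).trans (ih x)
      obtain ⟨n, hn⟩ := hc2 h ⟨hhP, fun b => by
        have := hgm (2 ^ m) (e.symm (q, b))
        rw [hh] at this
        simpa using this⟩
      refine ⟨n, fun b => ?_⟩
      rw [pow_mul, isWreath_pow_smul hh, hn, Perm.one_apply]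
    obtain ⟨n, hn⟩ := exists_pow_of_fibres key
    exact ⟨m + n, by simpa only [pow_add] using hn⟩

theorem actThreeByTwo_isWreath [Nonempty B] {P : Set (Perm B)} {e : Ω ≃ Q × B}
    (he : IsWreath (M := M) P e) {d : Q → ZMod 3}
    (hd : ∀ g : M, (∀ q, d (g • q) = d q) → ∃ m : ℕ, ∀ q : Q, g ^ 2 ^ m • q = q)
    {D : ZMod 3 → Set B} (hD : Function.Injective fun i => (D i).ncard)
    (h3 : ∀ i, ThreeByTwo (permStab P (D i))) :
    ActThreeByTwo M {x | (e x).2 ∈ D (d (e x).1)} := by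
  have hpres : ∀ g : M, (∀ x, g • x ∈ {x | (e x).2 ∈ D (d (e x).1)} ↔
      x ∈ {x | (e x).2 ∈ D (d (e x).1)}) → ∀ q, d (g • q) = d q := by
    intro g hg q
    obtain ⟨h, -, hh⟩ := he g q
    apply hD
    have : D (d q) = h ⁻¹' D (d (g • q)) := by
      ext b
      have := hg (e.symm (q, b))
      rw [hh] at this
      simpa using this.symm
    simp only [this]
    exact (Set.ncard_preimage_of_injective_subset_range h.injective
      fun x _ => h.surjective x).symm
  have hfix : ∀ g : M, (∀ x, g • x ∈ {x | (e x).2 ∈ D (d (e x).1)} ↔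
      x ∈ {x | (e x).2 ∈ D (d (e x).1)}) → (∀ q : Q, g • q = q) → ∀ q,
      ∃ h ∈ permStab P (D (d q)), ∀ b, g • e.symm (q, b) = e.symm (q, h b) := by
    intro g hg hgq q
    obtain ⟨h, hhP, hh⟩ := he g q
    rw [hgq] at hh
    refine ⟨h, ⟨hhP, fun b => ?_⟩, hh⟩
    have := hg (e.symm (q, b))
    rw [hh] at this
    simpa using this
  have hcube : ∀ g : M, (∀ x, g • x ∈ {x | (e x).2 ∈ D (d (e x).1)} ↔
      x ∈ {x | (e x).2 ∈ D (d (e x).1)}) → (∀ x : Ω, g ^ 3 • x = x) → ∀ q,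
      ∃ h ∈ permStab P (D (d q)), h ^ 3 = 1 ∧ ∀ b, g • e.symm (q, b) = e.symm (q, h b) := by
    intro g hg hg3 q
    have hq3 : ∀ q : Q, g ^ 3 • q = q := fun q => by
      obtain ⟨b⟩ := (inferInstance : Nonempty B)
      obtain ⟨h, -, hh⟩ := he (g ^ 3) q
      have := hh b
      rw [hg3] at this
      exact (congrArg Prod.fst (e.symm.injective this)).symm
    obtain ⟨m, hm⟩ := hd g (hpres g hg)
    have hgq : ∀ q : Q, g • q = q := by
      have : toPermHom M Q g = 1 := eq_one_of_pow_three_of_pow_two_pow (m := m)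
        (by rw [← map_pow]; ext q; exact hq3 q) (by rw [← map_pow]; ext q; exact hm q)
      exact fun q => Equiv.congr_fun this q
    obtain ⟨h, hhP, hh⟩ := hfix g hg hgq q
    refine ⟨h, hhP, ?_, hh⟩
    ext b
    have := isWreath_pow_smul hh 3 b
    rw [hg3] at this
    exact (congrArg Prod.snd (e.symm.injective this)).symm
  refine ⟨fun f g hf hg hf3 hg3 x => ?_, fun f hf => ?_⟩
  · obtain ⟨⟨q, b⟩, rfl⟩ := e.symm.surjective x
    obtain ⟨h, hhP, hh3, hh⟩ := hcube f hf hf3 q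
    obtain ⟨k, hkP, hk3, hk⟩ := hcube g hg hg3 q
    rw [hk, hh, hh, hk, ← Perm.mul_apply, (h3 _).1 h hhP k hkP hh3 hk3, Perm.mul_apply]
  · obtain ⟨m, hm⟩ := hd f (hpres f hf)
    have hfm : ∀ k : ℕ, ∀ x, f ^ k • x ∈ {x | (e x).2 ∈ D (d (e x).1)} ↔
        x ∈ {x | (e x).2 ∈ D (d (e x).1)} := fun k => by
      induction k with
      | zero => simp
      | succ k ih => intro x; rw [pow_succ', mul_smul, hf, ih]
    have key : ∀ q, ∃ n : ℕ, ∀ b,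
        f ^ (2 ^ m * 3 * 2 ^ n) • e.symm (q, b) = e.symm (q, b) := fun q => by
      obtain ⟨h, hhP, hh⟩ := hfix (f ^ 2 ^ m) (hfm _) hm q
      obtain ⟨n, hn⟩ := (h3 _).2 h hhP
      refine ⟨n, fun b => ?_⟩
      rw [mul_assoc, pow_mul, isWreath_pow_smul hh, hn, Perm.one_apply]
    obtain ⟨n, hn⟩ := exists_pow_of_fibres key
    refine ⟨m + n, fun x => ?_⟩
    rw [pow_add, ← mul_assoc, mul_comm 3]
    exact hn x

end Imprimitive

/-! ### Transitive groups -/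

section Transitive

open MulAction

theorem actColouring_quotient {M : Type*} [Group M] [Finite M] [Group.IsSolvable M]
    (K : Subgroup M) (hK : Fintype (M ⧸ K)) : ActColouring M (M ⧸ K) := by
  induction K using WellFoundedGT.induction with
  | ind K ih =>
    rcases subsingleton_or_nontrivial (M ⧸ K) with hs | hnt
    · refine ⟨fun _ => 0, ?_, fun g _ => ⟨0, fun q => Subsingleton.elim _ _⟩⟩
      simp [colourSum]
    · obtain ⟨H, hH, B, P, e, _, _, _, he⟩ := exists_isWreath (M := M) ((1 : M) : M ⧸ K)
      rw [stabilizer_quotient] at hH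
      have := Fintype.ofFinite B
      let hF := Fintype.ofFinite (M ⧸ H)
      exact (ih H hH hF).isWreath he (hasColouring_of_isPreprimitive P)

/-- The number of points of the given colour. -/
def classSize {Q : Type*} [Fintype Q] (d : Q → ZMod 3) (i : ZMod 3) : ℕ :=
  (Finset.univ.filter fun q => d q = i).card

theorem sum_comp_colour {Q A : Type*} [Fintype Q] [AddCommMonoid A] (d : Q → ZMod 3)
    (f : ZMod 3 → A) : ∑ q, f (d q) = ∑ i, classSize d i • f i := by
  rw [← Finset.sum_fiberwise Finset.univ d]
  refine Finset.sum_congr rfl fun i _ => ?_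
  rw [classSize, ← Finset.sum_const]
  exact Finset.sum_congr rfl fun q hq => by rw [(Finset.mem_filter.1 hq).2]

theorem sum_classSize {Q : Type*} [Fintype Q] (d : Q → ZMod 3) :
    classSize d 0 + classSize d 1 + classSize d 2 = Nat.card Q := by
  have := sum_comp_colour d fun _ => 1
  rw [Finset.sum_const, Finset.card_univ, smul_eq_mul, mul_one,
    show (∑ i : ZMod 3, classSize d i • 1) = ∑ i : Fin 3, classSize d i • 1 from rfl,
    Fin.sum_univ_three] at this
  rw [Nat.card_eq_fintype_card, this]
  simp only [smul_eq_mul, mul_one]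
  rfl

theorem not_classSize_eq {Q : Type*} [Fintype Q] {d : Q → ZMod 3} (hd : colourSum d ≠ 0) :
    ¬ (classSize d 0 = classSize d 1 ∧ classSize d 1 = classSize d 2) := by
  rintro ⟨h1, h2⟩
  have h : ∀ i, classSize d i = classSize d 0 := by
    intro i
    fin_cases i
    · rfl
    · exact h1.symm
    · exact (h1.trans h2).symm
  refine hd ?_
  rw [colourSum, sum_comp_colour d]
  simp only [h]
  rw [← Finset.smul_sum, AddChar.sum_eq_zero_of_ne_one, smul_zero]
  intro h0
  exact stdAddChar_one_ne_one (by rw [h0]; rfl)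

theorem ncard_blockUnion {Ω Q B : Type*} [Fintype Q] [Finite B] (e : Ω ≃ Q × B) (d : Q → ZMod 3)
    (D : ZMod 3 → Set B) : {x | (e x).2 ∈ D (d (e x).1)}.ncard =
      classSize d 0 * (D 0).ncard + classSize d 1 * (D 1).ncard +
        classSize d 2 * (D 2).ncard := by
  have h : Nat.card {x // (e x).2 ∈ D (d (e x).1)} = ∑ q, (D (d q)).ncard := by
    refine Eq.trans ?_ (Nat.card_sigma (β := fun q => D (d q)))
    refine (Nat.card_congr (Equiv.ofBijective
      (fun y : Σ q, D (d q) => ⟨e.symm (y.1, y.2.1), by simp⟩) ⟨?_, fun x => ?_⟩)).symm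
    · rintro ⟨q, b, hb⟩ ⟨q', b', hb'⟩ h
      obtain ⟨rfl, rfl⟩ := Prod.mk.inj (e.symm.injective (Subtype.mk.inj h))
      rfl
    · exact ⟨⟨(e x.1).1, (e x.1).2, x.2⟩, Subtype.ext (e.symm_apply_apply x.1)⟩
  refine h.trans ((sum_comp_colour d fun i => (D i).ncard).trans ?_)
  exact Fin.sum_univ_three fun i : Fin 3 => classSize d i • (D i).ncard

theorem eq_of_deviations {α β x y z : ℤ} (hβ : 0 ≤ β) (hαβ : β < α) (hx : 0 ≤ x) (hy : 0 ≤ y)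
    (hz : 0 ≤ z) (h1 : (α * (z - x) - β * y) ^ 2 = (α * (x - z) - β * y) ^ 2)
    (h2 : (α * (z - y) - β * x) ^ 2 = (α * (y - z) - β * x) ^ 2)
    (h3 : (α * (y - x) - β * z) ^ 2 = (α * (x - y) - β * z) ^ 2)
    (h4 : (α * (z - x) - β * y) ^ 2 = (α * (z - y) - β * x) ^ 2)
    (h5 : (α * (z - x) - β * y) ^ 2 = (α * (y - x) - β * z) ^ 2) : x = y ∧ y = z := by
  have hα : α ≠ 0 := by omega
  rcases hβ.eq_or_lt with rfl | hβ
  · have h6 : (z - x) ^ 2 = (z - y) ^ 2 := by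
      refine mul_left_cancel₀ (pow_ne_zero 2 hα) ?_
      linear_combination h4
    have h7 : (z - x) ^ 2 = (y - x) ^ 2 := by
      refine mul_left_cancel₀ (pow_ne_zero 2 hα) ?_
      linear_combination h5
    rcases sq_eq_sq_iff_eq_or_eq_neg.1 h6 with h | h <;>
      rcases sq_eq_sq_iff_eq_or_eq_neg.1 h7 with h' | h' <;> omega
  · have h0 : 4 * (α * β) ≠ 0 := mul_ne_zero (by norm_num) (mul_ne_zero hα hβ.ne')
    have e1 : (z - x) * y = 0 := mul_left_cancel₀ h0 (by linear_combination -h1)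
    have e2 : (z - y) * x = 0 := mul_left_cancel₀ h0 (by linear_combination -h2)
    have e3 : (y - x) * z = 0 := mul_left_cancel₀ h0 (by linear_combination -h3)
    have hne : α ^ 2 - β ^ 2 ≠ 0 := by nlinarith
    have key : ∀ t : ℤ, (α ^ 2 - β ^ 2) * t ^ 2 = 0 → t = 0 := fun t ht =>
      pow_eq_zero_iff two_ne_zero |>.1 ((mul_eq_zero.1 ht).resolve_left hne)
    rw [mul_eq_zero] at e1 e2 e3
    by_cases hx0 : x = 0 <;> by_cases hy0 : y = 0 <;> by_cases hz0 : z = 0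
    all_goals first
      | omega
      | (have := key x (by subst hy0 hz0; linear_combination h4); omega)
      | (have := key y (by subst hx0 hz0; linear_combination -h4); omega)
      | (have := key z (by subst hx0 hy0; linear_combination h5); omega)

theorem exists_ordered_sizes {M Ω : Type*} [Group M] [MulAction M Ω] [Finite Ω] {D E : Set Ω}
    (hD : ActThreeByTwo M D) (hE : ActThreeByTwo M E) (h1 : D.ncard ≠ E.ncard)
    (h2 : D.ncard + E.ncard ≠ Nat.card Ω) : ∃ D E : Set Ω, D.ncard < E.ncard ∧
      2 * E.ncard ≤ Nat.card Ω ∧ ActThreeByTwo M D ∧ ActThreeByTwo M E := by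
  have key : ∀ D : Set Ω, ActThreeByTwo M D → ∃ D' : Set Ω, ActThreeByTwo M D' ∧
      2 * D'.ncard ≤ Nat.card Ω ∧ (D'.ncard = D.ncard ∨ D'.ncard + D.ncard = Nat.card Ω) := by
    intro D hD
    by_cases h : 2 * D.ncard ≤ Nat.card Ω
    · exact ⟨D, hD, h, Or.inl rfl⟩
    · have := Set.ncard_add_ncard_compl D
      exact ⟨Dᶜ, hD.compl, by omega, Or.inr (by omega)⟩
  obtain ⟨D', hD', hD1, hD2⟩ := key D hD
  obtain ⟨E', hE', hE1, hE2⟩ := key E hE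
  rcases lt_trichotomy D'.ncard E'.ncard with h | h | h
  · exact ⟨D', E', h, hE1, hD', hE'⟩
  · omega
  · exact ⟨E', D', h, hD1, hE', hD'⟩

theorem exists_actThreeByTwo {M Ω : Type*} [Group M] [Finite M] [Group.IsSolvable M]
    [MulAction M Ω] [IsPretransitive M Ω] [Finite Ω] [Nontrivial Ω] :
    ∃ D E : Set Ω, D.ncard < E.ncard ∧ 2 * E.ncard ≤ Nat.card Ω ∧
      ActThreeByTwo M D ∧ ActThreeByTwo M E := by
  obtain ⟨a⟩ := (inferInstance : Nonempty Ω)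
  obtain ⟨H, -, B, P, e, _, _, _, he⟩ := exists_isWreath (M := M) a
  have := Fintype.ofFinite (M ⧸ H)
  obtain ⟨d, hd, hd2⟩ := actColouring_quotient H inferInstance
  obtain ⟨S, T, hST, hT, hS3, hT3⟩ := exists_threeByTwo_of_isPreprimitive P
  have hS3' := permStab_compl (P : Set (Perm B)) S ▸ hS3
  have hSc := Set.ncard_add_ncard_compl S
  have hn : Nat.card Ω = (classSize d 0 + classSize d 1 + classSize d 2) * Nat.card B := by
    rw [Nat.card_congr e, Nat.card_prod, sum_classSize]
  let A : Fin 3 → Set B := ![S, T, Sᶜ]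
  have hA : Function.Injective fun i => (A i).ncard := by
    intro i j hij
    fin_cases i <;> fin_cases j <;> simp [A] at hij ⊢ <;> omega
  have hA3 : ∀ i, ThreeByTwo (permStab (P : Set (Perm B)) (A i)) := by
    intro i
    fin_cases i
    · exact hS3
    · exact hT3
    · exact hS3'
  let Δ : Perm (Fin 3) → Set Ω := fun σ => {x | (e x).2 ∈ A (σ (d (e x).1))}
  have hΔ : ∀ σ, ActThreeByTwo M (Δ σ) := fun σ =>
    actThreeByTwo_isWreath he hd2 (D := fun i => A (σ i)) (hA.comp σ.injective) fun i => hA3 _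
  have hcard : ∀ σ, (Δ σ).ncard = classSize d 0 * (A (σ 0)).ncard +
      classSize d 1 * (A (σ 1)).ncard + classSize d 2 * (A (σ 2)).ncard := fun σ =>
    ncard_blockUnion e d fun i => A (σ i)
  by_contra hcon
  have hsq : ∀ σ τ, (2 * ((Δ σ).ncard : ℤ) - Nat.card Ω) ^ 2 =
      (2 * ((Δ τ).ncard : ℤ) - Nat.card Ω) ^ 2 := fun σ τ => by
    by_cases h1 : (Δ σ).ncard = (Δ τ).ncard
    · rw [h1]
    by_cases h2 : (Δ σ).ncard + (Δ τ).ncard = Nat.card Ω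
    · rw [← h2]; push_cast; ring
    · exact absurd (exists_ordered_sizes (hΔ σ) (hΔ τ) h1 h2) hcon
  refine not_classSize_eq hd ?_
  have hA0 : (A 0).ncard = S.ncard := rfl
  have hA1 : (A 1).ncard = T.ncard := rfl
  have hA2 : (A 2).ncard = Sᶜ.ncard := rfl
  have dev : ∀ σ, 2 * ((Δ σ).ncard : ℤ) - Nat.card Ω =
    classSize d 0 * (2 * ((A (σ 0)).ncard : ℤ) - Nat.card B) +
    classSize d 1 * (2 * ((A (σ 1)).ncard : ℤ) - Nat.card B) +
    classSize d 2 * (2 * ((A (σ 2)).ncard : ℤ) - Nat.card B) := fun σ => by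
      rw [hcard, hn]; push_cast; ring
  simp only [dev] at hsq
  have k1 := hsq 1 (swap 0 2)
  have k2 := hsq (swap 0 1) (swap 0 2 * swap 0 1)
  have k3 := hsq (swap 1 2) (swap 0 2 * swap 1 2)
  have k4 := hsq 1 (swap 0 1)
  have k5 := hsq 1 (swap 1 2)
  simp only [show (1 : Perm (Fin 3)) 0 = 0 from rfl, show (1 : Perm (Fin 3)) 1 = 1 from rfl,
    show (1 : Perm (Fin 3)) 2 = 2 from rfl] at k1 k4 k5
  simp [swap_apply_def, hA0, hA1, hA2] at k1 k2 k3 k4 k5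
  rw [Nat.card_coe_set_eq] at hSc hT
  have hSc' : (Sᶜ.ncard : ℤ) = B.ncard - S.ncard := by omega
  rw [hSc'] at k1 k2 k3 k4 k5
  have := eq_of_deviations (α := B.ncard - 2 * S.ncard) (β := B.ncard - 2 * T.ncard)
    (x := classSize d 0) (y := classSize d 1) (z := classSize d 2) (by omega) (by omega)
    (by omega) (by omega) (by omega) (by linear_combination k1) (by linear_combination k2)
    (by linear_combination k3) (by linear_combination k4) (by linear_combination k5)
  exact_mod_cast this

end Transitive

/-! ### Intransitive groups -/

section Intransitive

open MulAction

theorem exists_actThreeByTwo_orbit {M Ω : Type*} [Group M] [Finite M] [Group.IsSolvable M]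
    [MulAction M Ω] [IsPretransitive M Ω] [Finite Ω] :
    ∃ D E : Set Ω, D.ncard ≤ E.ncard ∧ (Nontrivial Ω → D.ncard < E.ncard) ∧
      2 * E.ncard ≤ Nat.card Ω ∧ ActThreeByTwo M D ∧ ActThreeByTwo M E := by
  rcases subsingleton_or_nontrivial Ω with hs | hnt
  · have h : ActThreeByTwo M (∅ : Set Ω) :=
      ⟨fun _ _ _ _ _ _ _ => Subsingleton.elim _ _, fun _ _ => ⟨0, fun _ => Subsingleton.elim _ _⟩⟩
    exact ⟨∅, ∅, le_rfl, fun h => absurd h (not_nontrivial Ω), by simp, h, h⟩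
  · obtain ⟨D, E, h1, h2⟩ := exists_actThreeByTwo (M := M) (Ω := Ω)
    exact ⟨D, E, h1.le, fun _ => h1, h2⟩

theorem mem_orbit_mk {M Ω : Type*} [Group M] [MulAction M Ω] (x : Ω) :
    x ∈ orbitRel.Quotient.orbit (Quotient.mk'' x : orbitRel.Quotient M Ω) :=
  orbitRel.Quotient.mem_orbit.2 rfl

/-- The union over all orbits of the given subsets. -/
def orbitUnion {M Ω : Type*} [Group M] [MulAction M Ω]
    (D : ∀ ω : orbitRel.Quotient M Ω, Set ω.orbit) : Set Ω :=
  {x | ⟨x, mem_orbit_mk x⟩ ∈ D (Quotient.mk'' x)}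

theorem mem_orbitUnion {M Ω : Type*} [Group M] [MulAction M Ω]
    {D : ∀ ω : orbitRel.Quotient M Ω, Set ω.orbit} {ω : orbitRel.Quotient M Ω} (x : ω.orbit) :
    (x : Ω) ∈ orbitUnion D ↔ x ∈ D ω := by
  obtain ⟨x, hx⟩ := x
  obtain rfl := orbitRel.Quotient.mem_orbit.1 hx
  rfl

theorem ncard_orbitUnion {M Ω : Type*} [Group M] [MulAction M Ω] [Finite Ω]
    [Fintype (orbitRel.Quotient M Ω)] (D : ∀ ω : orbitRel.Quotient M Ω, Set ω.orbit) :
    (orbitUnion D).ncard = ∑ ω, (D ω).ncard := by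
  refine Eq.trans ?_ (Nat.card_sigma (β := fun ω => D ω))
  refine (Nat.card_congr (Equiv.ofBijective
    (fun y : Σ ω, D ω => (⟨y.2.1, (mem_orbitUnion y.2.1).2 y.2.2⟩ : orbitUnion D))
      ⟨?_, fun x => ?_⟩)).symm
  · rintro ⟨_, ⟨x, hx'⟩, hx⟩ ⟨_, ⟨y, hy'⟩, hy⟩ h
    obtain rfl := orbitRel.Quotient.mem_orbit.1 hx'
    obtain rfl := orbitRel.Quotient.mem_orbit.1 hy'
    obtain rfl : x = y := Subtype.mk.inj h
    rfl
  · exact ⟨⟨Quotient.mk'' x.1, ⟨x.1, mem_orbit_mk x.1⟩, x.2⟩, rfl⟩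

theorem ncard_univ_eq_sum_orbit {M Ω : Type*} [Group M] [MulAction M Ω] [Finite Ω]
    [Fintype (orbitRel.Quotient M Ω)] :
    Nat.card Ω = ∑ ω : orbitRel.Quotient M Ω, Nat.card ω.orbit := by
  rw [Nat.card_congr (selfEquivSigmaOrbits' M Ω), Nat.card_sigma]

theorem actThreeByTwo_orbitUnion {M Ω : Type*} [Group M] [MulAction M Ω] [Finite Ω]
    {D : ∀ ω : orbitRel.Quotient M Ω, Set ω.orbit} (hD : ∀ ω, ActThreeByTwo M (D ω)) :
    ActThreeByTwo M (orbitUnion D) := by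
  have hstab : ∀ g : M, (∀ x, g • x ∈ orbitUnion D ↔ x ∈ orbitUnion D) →
      ∀ (ω : orbitRel.Quotient M Ω) (x : ω.orbit), g • x ∈ D ω ↔ x ∈ D ω := fun g hg ω x => by
    rw [← mem_orbitUnion, ← mem_orbitUnion]
    exact hg x
  refine ⟨fun f g hf hg hf3 hg3 x => ?_, fun f hf => ?_⟩
  · exact congrArg Subtype.val ((hD (Quotient.mk'' x)).1 f g (hstab f hf _) (hstab g hg _)
      (fun y => Subtype.ext (hf3 y)) (fun y => Subtype.ext (hg3 y)) ⟨x, mem_orbit_mk x⟩)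
  · choose m hm using fun ω => (hD ω).2 f (hstab f hf ω)
    obtain ⟨N, hN⟩ := Finite.exists_le m
    exact ⟨N, fun x => pow_smul_eq_of_dvd (congrArg Subtype.val (hm (Quotient.mk'' x) ⟨x, mem_orbit_mk x⟩))
      (mul_dvd_mul_left 3 (pow_dvd_pow 2 (hN _)))⟩

theorem ActThreeByTwo.requiredStructure {M Ω : Type*} [Group M] [MulAction M Ω]
    [FaithfulSMul M Ω] {D : Set Ω} (h : ActThreeByTwo M D) :
    RequiredStructure (stabilizer M D) := by
  have hs : ∀ (f : stabilizer M D) (x : Ω), (f : M) • x ∈ D ↔ x ∈ D := fun f =>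
    mem_stabilizer_set.1 f.2
  have h1 : ∀ (f : stabilizer M D) (n : ℕ), f ^ n = 1 ↔ ∀ x : Ω, (f : M) ^ n • x = x := by
    intro f n
    refine ⟨fun hf x => ?_, fun hf => Subtype.ext (FaithfulSMul.eq_of_smul_eq_smul fun x : Ω => ?_)⟩
    · rw [← SubgroupClass.coe_pow, hf, OneMemClass.coe_one, one_smul]
    · exact (hf x).trans (one_smul M x).symm
  refine ThreeByTwo.requiredStructure ⟨fun f _ g _ hf hg => ?_, fun f _ => ?_⟩
  · refine Subtype.ext (FaithfulSMul.eq_of_smul_eq_smul fun x : Ω => ?_)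
    simp only [Subgroup.coe_mul, mul_smul]
    exact h.1 f g (hs f) (hs g) ((h1 f 3).1 hf) ((h1 g 3).1 hg) x
  · obtain ⟨m, hm⟩ := h.2 f (hs f)
    exact ⟨m, (h1 f _).2 hm⟩

theorem isNice_of_isSolvable {Ω : Type*} [Fintype Ω] (G : Subgroup (Perm Ω)) (hG : G ≠ ⊥)
    [Group.IsSolvable G] : IsNice Ω G := by
  have := Fintype.ofFinite (orbitRel.Quotient G Ω)
  choose D E h1 h2 h3 hD hE using fun ω : orbitRel.Quotient G Ω =>
    exists_actThreeByTwo_orbit (M := G) (Ω := ω.orbit)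
  refine ⟨orbitUnion D, orbitUnion E, ?_, ?_, (actThreeByTwo_orbitUnion hD).requiredStructure,
    (actThreeByTwo_orbitUnion hE).requiredStructure⟩
  · rw [ncard_orbitUnion, ncard_orbitUnion]
    obtain ⟨g, hg1⟩ := Subgroup.ne_bot_iff_exists_ne_one.1 hG
    obtain ⟨x, hx⟩ : ∃ x, (g : Perm Ω) x ≠ x := by
      by_contra! h
      exact hg1 (Subtype.ext (Perm.ext h))
    refine Finset.sum_lt_sum (fun ω _ => h1 ω) ⟨Quotient.mk'' x, Finset.mem_univ _, h2 _ ?_⟩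
    let y : orbitRel.Quotient.orbit (Quotient.mk'' x : orbitRel.Quotient G Ω) := ⟨x, mem_orbit_mk x⟩
    exact ⟨g • y, y, fun h => hx (congrArg Subtype.val h)⟩
  · rw [ncard_orbitUnion, ← Nat.card_eq_fintype_card, ncard_univ_eq_sum_orbit (M := G),
      Finset.mul_sum]
    exact Finset.sum_le_sum fun ω _ => h3 ω

end Intransitive

end SolvableNice

/-- Theorem 3.2: every nontrivial finite solvable permutation group is nice. -/
theorem stmt_1 {Ω : Type*} [Fintype Ω] (G : Subgroup (Equiv.Perm Ω))
    (hG : G ≠ ⊥) (hsolv : IsSolvable G) :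
    IsNice Ω G :=
  have : Group.IsSolvable G := hsolv
  SolvableNice.isNice_of_isSolvable G hG
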